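/- arXiv:1306.0329 — 4 statements merged into one kernel-verified Lean document; each statement's English description precedes it below -/
import Mathlib

section
/- (Comparison principle on a junction) Assume (A0) and (A1′) and let T > 0. Let ū be a viscosity subsolution and u̲ a viscosity supersolution of (HJ)-(CI) on [0,T)×J, and assume there is a constant C_T > 0 such that ū(t,y) ≤ C_T(1+|y|) and u̲(t,y) ≥ −C_T(1+|y|) for all (t,y) ∈ [0,T)×J. Then ū ≤ u̲ on (0,T)×J. -/
open Set Filter

/-- Assumption (A1) for a single Hamiltonian: `H` is `C¹`, coercive
(`H p → +∞` as `|p| → +∞`), non-increasing on `(-∞, p₀]` and non-decreasing on `[p₀, +∞)`. -/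
def A1cond (H : ℝ → ℝ) (p₀ : ℝ) : Prop :=
  ContDiff ℝ 1 H ∧ Tendsto H (cocompact ℝ) atTop ∧
    AntitoneOn H (Iic p₀) ∧ MonotoneOn H (Ici p₀)

/-- The non-increasing envelope `H⁻` of `H` with turning point `p₀`. -/
noncomputable def Hm (H : ℝ → ℝ) (p₀ : ℝ) (p : ℝ) : ℝ :=
  if p ≤ p₀ then H p else H p₀

/-- The non-decreasing envelope `H⁺` of `H` with turning point `p₀`. -/
noncomputable def Hp (H : ℝ → ℝ) (p₀ : ℝ) (p : ℝ) : ℝ :=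
  if p ≤ p₀ then H p₀ else H p

/-- One time step of the numerical scheme (NS) on the junction:
`V` (the values at time `n+1`) is computed from `U` (the values at time `n`).
For `i ≥ 1` on each branch `α` the update uses
`max (H⁺_α(p_{i,-}), H⁻_α(p_{i,+}))`; at the junction point `i = 0` all branches share a
common value and the update uses `max_β H⁻_β(p^β_{0,+})`. -/
def SchemeStep {N : ℕ} (H : Fin N → ℝ → ℝ) (p₀ : Fin N → ℝ) (Δx Δt : ℝ)
    (U V : Fin N → ℕ → ℝ) : Prop :=
  (∀ (α : Fin N) (i : ℕ), 1 ≤ i →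
      V α i = U α i - Δt * max (Hp (H α) (p₀ α) ((U α i - U α (i - 1)) / Δx))
        (Hm (H α) (p₀ α) ((U α (i + 1) - U α i) / Δx))) ∧
  (∀ α β : Fin N, U α 0 = U β 0) ∧
  (∀ α : Fin N, V α 0 = U α 0 - Δt *
      sSup (Set.range fun β : Fin N => Hm (H β) (p₀ β) ((U β 1 - U β 0) / Δx)))

/-- The numerical scheme (NS): `U α n i` is the value on branch `α` at time step `n`
and grid point `i`. -/
def SchemeNS {N : ℕ} (H : Fin N → ℝ → ℝ) (p₀ : Fin N → ℝ) (Δx Δt : ℝ)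
    (U : Fin N → ℕ → ℕ → ℝ) : Prop :=
  ∀ n : ℕ, SchemeStep H p₀ Δx Δt (fun α i => U α n i) (fun α i => U α (n + 1) i)

/-- Viscosity subsolution of the Hamilton–Jacobi equation (HJ) on the junction, on
`J_T = (0,T) × J`. The junction is encoded by the family of branch restrictions
`u α t x` (`x ≥ 0`), sharing a common value at the junction point `x = 0`. -/
def IsViscSubSol {N : ℕ} (T : ℝ) (H : Fin N → ℝ → ℝ) (p₀ : Fin N → ℝ)
    (u : Fin N → ℝ → ℝ → ℝ) : Prop :=
  (∀ α, UpperSemicontinuousOn (fun q : ℝ × ℝ => u α q.1 q.2) (Ico 0 T ×ˢ Ici 0)) ∧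
  (∀ (α β : Fin N) (t : ℝ), u α t 0 = u β t 0) ∧
  (∀ φ : Fin N → ℝ → ℝ → ℝ,
    (∀ α, ContDiffOn ℝ 1 (fun q : ℝ × ℝ => φ α q.1 q.2) (Ioo 0 T ×ˢ Ici 0)) →
    (∀ (α β : Fin N) (t : ℝ), φ α t 0 = φ β t 0) →
    (∀ (β : Fin N) (t x : ℝ), t ∈ Ioo 0 T → 0 ≤ x → u β t x ≤ φ β t x) →
    ((∀ (α : Fin N) (t x : ℝ), t ∈ Ioo 0 T → 0 < x → u α t x = φ α t x →
        deriv (fun s => φ α s x) t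
          + H α (derivWithin (fun y => φ α t y) (Ici 0) x) ≤ 0) ∧
     (∀ t : ℝ, t ∈ Ioo 0 T → (∀ α : Fin N, u α t 0 = φ α t 0) → ∀ α : Fin N,
        deriv (fun s => φ α s 0) t
          + sSup (Set.range fun β : Fin N =>
              Hm (H β) (p₀ β) (derivWithin (fun y => φ β t y) (Ici 0) 0)) ≤ 0)))

/-- Viscosity supersolution of (HJ) on the junction, on `J_T = (0,T) × J`. -/
def IsViscSuperSol {N : ℕ} (T : ℝ) (H : Fin N → ℝ → ℝ) (p₀ : Fin N → ℝ)
    (u : Fin N → ℝ → ℝ → ℝ) : Prop :=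
  (∀ α, LowerSemicontinuousOn (fun q : ℝ × ℝ => u α q.1 q.2) (Ico 0 T ×ˢ Ici 0)) ∧
  (∀ (α β : Fin N) (t : ℝ), u α t 0 = u β t 0) ∧
  (∀ φ : Fin N → ℝ → ℝ → ℝ,
    (∀ α, ContDiffOn ℝ 1 (fun q : ℝ × ℝ => φ α q.1 q.2) (Ioo 0 T ×ˢ Ici 0)) →
    (∀ (α β : Fin N) (t : ℝ), φ α t 0 = φ β t 0) →
    (∀ (β : Fin N) (t x : ℝ), t ∈ Ioo 0 T → 0 ≤ x → φ β t x ≤ u β t x) →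
    ((∀ (α : Fin N) (t x : ℝ), t ∈ Ioo 0 T → 0 < x → u α t x = φ α t x →
        0 ≤ deriv (fun s => φ α s x) t
          + H α (derivWithin (fun y => φ α t y) (Ici 0) x)) ∧
     (∀ t : ℝ, t ∈ Ioo 0 T → (∀ α : Fin N, u α t 0 = φ α t 0) → ∀ α : Fin N,
        0 ≤ deriv (fun s => φ α s 0) t
          + sSup (Set.range fun β : Fin N =>
              Hm (H β) (p₀ β) (derivWithin (fun y => φ β t y) (Ici 0) 0)))))

/-- Viscosity subsolution of (HJ)-(CI): subsolution of (HJ) on `J_T` with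
`u(0,·) ≤ u₀` on `J`. -/
def IsViscSubSolCI {N : ℕ} (T : ℝ) (H : Fin N → ℝ → ℝ) (p₀ : Fin N → ℝ)
    (u₀ : Fin N → ℝ → ℝ) (u : Fin N → ℝ → ℝ → ℝ) : Prop :=
  IsViscSubSol T H p₀ u ∧ ∀ (α : Fin N) (x : ℝ), 0 ≤ x → u α 0 x ≤ u₀ α x

/-- Viscosity supersolution of (HJ)-(CI): supersolution of (HJ) on `J_T` with
`u(0,·) ≥ u₀` on `J`. -/
def IsViscSuperSolCI {N : ℕ} (T : ℝ) (H : Fin N → ℝ → ℝ) (p₀ : Fin N → ℝ)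
    (u₀ : Fin N → ℝ → ℝ) (u : Fin N → ℝ → ℝ → ℝ) : Prop :=
  IsViscSuperSol T H p₀ u ∧ ∀ (α : Fin N) (x : ℝ), 0 ≤ x → u₀ α x ≤ u α 0 x

/-- Viscosity solution of (HJ)-(CI) on `[0,T) × J`. -/
def IsViscSolCI {N : ℕ} (T : ℝ) (H : Fin N → ℝ → ℝ) (p₀ : Fin N → ℝ)
    (u₀ : Fin N → ℝ → ℝ) (u : Fin N → ℝ → ℝ → ℝ) : Prop :=
  IsViscSubSolCI T H p₀ u₀ u ∧ IsViscSuperSolCI T H p₀ u₀ u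

/-- Assumption (A0): Lipschitz initial data on each branch, with a common value at the
junction point. -/
def A0cond {N : ℕ} (u₀ : Fin N → ℝ → ℝ) : Prop :=
  (∀ α, ∃ C : NNReal, LipschitzOnWith C (u₀ α) (Ici 0)) ∧
  (∀ α β : Fin N, u₀ α 0 = u₀ β 0)

/-- Assumption (A1′): each `H_α` is the Legendre–Fenchel transform of a uniformly convex
`C²` Lagrangian `L_α`, and `H⁻_α`, `H⁺_α` are the corresponding one-sided transforms. -/
def A1primeCond {N : ℕ} (H : Fin N → ℝ → ℝ) (p₀ : Fin N → ℝ) : Prop :=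
  ∃ (γ : ℝ) (L : Fin N → ℝ → ℝ), 0 < γ ∧
    (∀ α, ContDiff ℝ 2 (L α)) ∧
    (∀ (α : Fin N) (q : ℝ), γ ≤ deriv (deriv (L α)) q) ∧
    (∀ (α : Fin N) (p : ℝ), H α p = sSup (Set.range fun q : ℝ => p * q - L α q)) ∧
    (∀ (α : Fin N) (p : ℝ),
      Hm (H α) (p₀ α) p = sSup ((fun q : ℝ => p * q - L α q) '' Iic 0)) ∧
    (∀ (α : Fin N) (p : ℝ),
      Hp (H α) (p₀ α) p = sSup ((fun q : ℝ => p * q - L α q) '' Ici 0))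

/-- The CFL condition (CFL′) for the scheme (NS): `Δx/Δt` dominates `|H'_α|` on
`[p̲_α, p̄_α]`, where `p̲_α, p̄_α` are determined by the level `-m⁰`,
`m⁰ = inf_{β,i} W^{β,0}_i`. -/
def CFLprime {N : ℕ} (H : Fin N → ℝ → ℝ) (p₀ : Fin N → ℝ) (Δx Δt : ℝ)
    (U : Fin N → ℕ → ℕ → ℝ) : Prop :=
  ∀ α : Fin N, ∀ p ∈ Icc
      (sInf {p : ℝ | Hm (H α) (p₀ α) p =
        -(sInf (Set.range fun q : Fin N × ℕ => (U q.1 1 q.2 - U q.1 0 q.2) / Δt))})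
      (sSup {p : ℝ | Hp (H α) (p₀ α) p =
        -(sInf (Set.range fun q : Fin N × ℕ => (U q.1 1 q.2 - U q.1 0 q.2) / Δt))}),
    |deriv (H α) p| ≤ Δx / Δt

/-- A function of two real variables with jointly continuous partial derivatives is `C¹`. -/
theorem contDiff_one_of_partial {f f₁ f₂ : ℝ → ℝ → ℝ}
    (h₁ : ∀ t x, HasDerivAt (fun s => f s x) (f₁ t x) t)
    (h₂ : ∀ t x, HasDerivAt (fun y => f t y) (f₂ t x) x)
    (c₁ : Continuous fun q : ℝ × ℝ => f₁ q.1 q.2)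
    (c₂ : Continuous fun q : ℝ × ℝ => f₂ q.1 q.2) :
    ContDiff ℝ 1 (fun q : ℝ × ℝ => f q.1 q.2) := by
  have key := fun u : ℝ × ℝ => (hasStrictFDerivAt_uncurry_coprod (𝕜 := ℝ) (u := u) (f := f)
    (f₁ := fun t x => ContinuousLinearMap.toSpanSingleton ℝ (f₁ t x))
    (f₂ := fun t x => ContinuousLinearMap.toSpanSingleton ℝ (f₂ t x))
    (Eventually.of_forall fun v => (h₁ v.1 v.2).hasFDerivAt)
    (Eventually.of_forall fun v => (h₂ v.1 v.2).hasFDerivAt)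
    (((ContinuousLinearMap.toSpanSingletonCLE (𝕜 := ℝ) (E := ℝ)).continuous.comp c₁).continuousAt)
    (((ContinuousLinearMap.toSpanSingletonCLE
      (𝕜 := ℝ) (E := ℝ)).continuous.comp c₂).continuousAt)).hasFDerivAt
  refine contDiff_one_iff_hasFDerivAt.2 ⟨_, ?_, key⟩
  have e₁ : Continuous fun u : ℝ × ℝ => ContinuousLinearMap.toSpanSingleton ℝ (f₁ u.1 u.2) :=
    (ContinuousLinearMap.toSpanSingletonCLE (𝕜 := ℝ) (E := ℝ)).continuous.comp c₁
  have e₂ : Continuous fun u : ℝ × ℝ => ContinuousLinearMap.toSpanSingleton ℝ (f₂ u.1 u.2) :=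
    (ContinuousLinearMap.toSpanSingletonCLE (𝕜 := ℝ) (E := ℝ)).continuous.comp c₂
  exact e₁.continuousLinearMapCoprod e₂

/-- Derivative of a `C¹` function of two variables along a line, in terms of its partial
derivatives. -/
theorem hasDerivAt_along_line {f : ℝ → ℝ → ℝ} {a b t x : ℝ}
    (hf : DifferentiableAt ℝ (fun q : ℝ × ℝ => f q.1 q.2) (t, x))
    (h₁ : HasDerivAt (fun s => f s x) a t) (h₂ : HasDerivAt (fun y => f t y) b x) (q : ℝ) :
    HasDerivAt (fun h => f (t + h) (x + q * h)) (a + q * b) 0 := by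
  obtain ⟨D, hD⟩ := hf
  have l₁ : HasDerivAt (fun s : ℝ => (s, x)) ((1 : ℝ), (0 : ℝ)) t :=
    (hasDerivAt_id t).prodMk (hasDerivAt_const t x)
  have l₂ : HasDerivAt (fun y : ℝ => (t, y)) ((0 : ℝ), (1 : ℝ)) x :=
    (hasDerivAt_const x t).prodMk (hasDerivAt_id x)
  have l₃ : HasDerivAt (fun h : ℝ => (t + h, x + q * h)) ((1 : ℝ), q) 0 := by
    have := ((hasDerivAt_id (0 : ℝ)).const_add t).prodMk
      (((hasDerivAt_id (0 : ℝ)).const_mul q).const_add x)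
    simpa using this
  have d₁ := HasFDerivAt.comp_hasDerivAt (l := fun p : ℝ × ℝ => f p.1 p.2) t hD l₁
  have d₂ := HasFDerivAt.comp_hasDerivAt (l := fun p : ℝ × ℝ => f p.1 p.2) x hD l₂
  replace d₁ : D (1, 0) = a := d₁.unique h₁
  replace d₂ : D (0, 1) = b := d₂.unique h₂
  have hD' : HasFDerivAt (fun p : ℝ × ℝ => f p.1 p.2) D (t + 0, x + q * 0) := by simpa using hD
  have := hD'.comp_hasDerivAt (0 : ℝ) l₃
  have e : D (1, q) = a + q * b := by
    have : ((1 : ℝ), q) = (1, 0) + q • (0, 1) := by simp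
    rw [this, map_add, map_smul, d₁, d₂, smul_eq_mul]
  rw [e] at this
  exact this

/-- The derivative of a one-dimensional Steklov average. -/
theorem hasDerivAt_steklov {k : ℝ → ℝ} (hk : Continuous k) {d : ℝ} (hd : d ≠ 0) (t : ℝ) :
    HasDerivAt (fun r => ∫ s in (0 : ℝ)..1, k (r + d * s)) ((k (t + d) - k t) / d) t := by
  have e : (fun r => ∫ s in (0 : ℝ)..1, k (r + d * s)) =
      fun r => d⁻¹ * ((∫ s in (0 : ℝ)..(r + d), k s) - ∫ s in (0 : ℝ)..r, k s) := by
    funext r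
    rw [intervalIntegral.integral_comp_add_mul k hd r,
      intervalIntegral.integral_interval_sub_left (hk.intervalIntegrable _ _)
        (hk.intervalIntegrable _ _)]
    simp
  rw [e]
  have h₁ := (hk.integral_hasStrictDerivAt 0 (t + d)).hasDerivAt.comp_add_const t d
  have h₂ := (hk.integral_hasStrictDerivAt 0 t).hasDerivAt
  rw [div_eq_inv_mul]
  exact (h₁.sub h₂).const_mul d⁻¹

/-- The average of `f` over the times in `[t - δ, t]`. -/
noncomputable def timeAvg (δ : ℝ) (f : ℝ → ℝ → ℝ) (t x : ℝ) : ℝ :=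
  ∫ s in (0 : ℝ)..1, f (t - δ * s) x

/-- The average of `f` over the positions in `[x, x + ε]`. -/
noncomputable def spaceAvg (ε : ℝ) (f : ℝ → ℝ → ℝ) (t x : ℝ) : ℝ :=
  ∫ y in (0 : ℝ)..1, f t (x + ε * y)

section Averages

variable {f : ℝ → ℝ → ℝ} {δ ε : ℝ}

theorem continuous_timeAvg (hf : Continuous fun q : ℝ × ℝ => f q.1 q.2) :
    Continuous fun q : ℝ × ℝ => timeAvg δ f q.1 q.2 :=
  intervalIntegral.continuous_parametric_intervalIntegral_of_continuous'
    (f := fun (q : ℝ × ℝ) s => f (q.1 - δ * s) q.2)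
    (hf.comp (by fun_prop : Continuous fun p : (ℝ × ℝ) × ℝ => (p.1.1 - δ * p.2, p.1.2))) _ _

theorem continuous_spaceAvg (hf : Continuous fun q : ℝ × ℝ => f q.1 q.2) :
    Continuous fun q : ℝ × ℝ => spaceAvg ε f q.1 q.2 :=
  intervalIntegral.continuous_parametric_intervalIntegral_of_continuous'
    (f := fun (q : ℝ × ℝ) s => f q.1 (q.2 + ε * s))
    (hf.comp (by fun_prop : Continuous fun p : (ℝ × ℝ) × ℝ => (p.1.1, p.1.2 + ε * p.2))) _ _

theorem spaceAvg_timeAvg_comm (hf : Continuous fun q : ℝ × ℝ => f q.1 q.2) (t x : ℝ) :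
    spaceAvg ε (timeAvg δ f) t x = timeAvg δ (spaceAvg ε f) t x := by
  have hc : Continuous fun p : ℝ × ℝ => f (t - δ * p.2) (x + ε * p.1) :=
    hf.comp (by fun_prop : Continuous fun p : ℝ × ℝ => (t - δ * p.2, x + ε * p.1))
  simp only [spaceAvg, timeAvg]
  refine MeasureTheory.intervalIntegral_intervalIntegral_swap
    (F := fun y s => f (t - δ * s) (x + ε * y)) ?_
  refine MeasureTheory.IntegrableOn.mono_set (t := uIcc 0 1 ×ˢ uIcc 0 1) ?_
    (prod_mono uIoc_subset_uIcc uIoc_subset_uIcc)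
  exact hc.continuousOn.integrableOn_compact (isCompact_uIcc.prod isCompact_uIcc)

theorem hasDerivAt_timeAvg (hf : Continuous fun q : ℝ × ℝ => f q.1 q.2) (hδ : δ ≠ 0) (t x : ℝ) :
    HasDerivAt (fun s => timeAvg δ f s x) ((f t x - f (t - δ) x) / δ) t := by
  have := hasDerivAt_steklov (k := fun s => f s x)
    (hf.comp (by fun_prop : Continuous fun s : ℝ => (s, x))) (neg_ne_zero.2 hδ) t
  simp only [neg_mul, ← sub_eq_add_neg] at this
  rwa [div_neg, ← neg_div, neg_sub] at this

theorem hasDerivAt_spaceAvg (hf : Continuous fun q : ℝ × ℝ => f q.1 q.2) (hε : ε ≠ 0) (t x : ℝ) :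
    HasDerivAt (fun y => spaceAvg ε f t y) ((f t (x + ε) - f t x) / ε) x :=
  hasDerivAt_steklov (k := fun y => f t y)
    (hf.comp (by fun_prop : Continuous fun y : ℝ => (t, y))) hε x

theorem hasDerivAt_spaceAvg_timeAvg (hf : Continuous fun q : ℝ × ℝ => f q.1 q.2) (hδ : δ ≠ 0)
    (t x : ℝ) :
    HasDerivAt (fun s => spaceAvg ε (timeAvg δ f) s x)
      ((spaceAvg ε f t x - spaceAvg ε f (t - δ) x) / δ) t := by
  simp only [spaceAvg_timeAvg_comm hf]
  exact hasDerivAt_timeAvg (continuous_spaceAvg hf) hδ t x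

theorem contDiff_spaceAvg_timeAvg (hf : Continuous fun q : ℝ × ℝ => f q.1 q.2) (hδ : δ ≠ 0)
    (hε : ε ≠ 0) : ContDiff ℝ 1 (fun q : ℝ × ℝ => spaceAvg ε (timeAvg δ f) q.1 q.2) := by
  refine contDiff_one_of_partial (hasDerivAt_spaceAvg_timeAvg hf hδ)
    (hasDerivAt_spaceAvg (continuous_timeAvg hf) hε) ?_ ?_
  · exact ((continuous_spaceAvg hf).sub ((continuous_spaceAvg hf).comp
      (by fun_prop : Continuous fun q : ℝ × ℝ => (q.1 - δ, q.2)))).div_const _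
  · exact (((continuous_timeAvg hf).comp
      (by fun_prop : Continuous fun q : ℝ × ℝ => (q.1, q.2 + ε))).sub
        (continuous_timeAvg hf)).div_const _

end Averages

/-- `w` grows at most at the rate `L q` along segments of velocity `q` in the half line, up to
time `S`. -/
def LineIneq (L : ℝ → ℝ) (S : ℝ) (w : ℝ → ℝ → ℝ) : Prop :=
  ∀ t x q h, 0 < h → 0 ≤ x → 0 ≤ x + q * h → t + h ≤ S → w (t + h) (x + q * h) ≤ w t x + h * L q

section LineIneq

variable {L : ℝ → ℝ} {S δ ε : ℝ} {w : ℝ → ℝ → ℝ}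

theorem LineIneq.le_of_lt (hw : LineIneq L S w) {s t x : ℝ} (hst : s < t) (ht : t ≤ S)
    (hx : 0 ≤ x) : w t x ≤ w s x + (t - s) * L 0 := by
  simpa using hw s x 0 (t - s) (sub_pos.2 hst) hx (by simpa) (by linarith)

theorem LineIneq.le_of_lt' (hw : LineIneq L S w) {s t x y : ℝ} (hst : s < t) (ht : t ≤ S)
    (hx : 0 ≤ x) (hy : 0 ≤ y) : w t y ≤ w s x + (t - s) * L ((y - x) / (t - s)) := by
  have h0 : 0 < t - s := sub_pos.2 hst
  have e : x + (y - x) / (t - s) * (t - s) = y := by field_simp; ring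
  have := hw s x ((y - x) / (t - s)) (t - s) h0 hx (by rwa [e]) (by linarith)
  rwa [e, add_sub_cancel] at this

theorem LineIneq.intervalIntegrable (hw : LineIneq L S w) (hδ : 0 < δ) {t x : ℝ} (ht : t ≤ S)
    (hx : 0 ≤ x) :
    IntervalIntegrable (fun s => w (t - δ * s) x) MeasureTheory.volume 0 1 := by
  have hm : MonotoneOn (fun s => w (t - δ * s) x + δ * s * L 0) (uIcc 0 1) := by
    intro a ha b hb hab
    rw [uIcc_of_le zero_le_one] at ha hb
    rcases hab.eq_or_lt with rfl | hab
    · rfl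
    · have := hw.le_of_lt (s := t - δ * b) (t := t - δ * a) (by nlinarith)
        (by nlinarith [mul_nonneg hδ.le ha.1]) hx
      simp only
      linarith
  have hc : IntervalIntegrable (fun s => δ * s * L 0) MeasureTheory.volume 0 1 :=
    Continuous.intervalIntegrable (by fun_prop) _ _
  simpa using hm.intervalIntegrable.sub hc

theorem LineIneq.timeAvg (hw : LineIneq L S w) (hδ : 0 < δ) : LineIneq L S (timeAvg δ w) := by
  intro t x q h hh hx hxq ht
  have hi := hw.intervalIntegrable hδ (t := t) (by linarith) hx
  have : ∫ s in (0 : ℝ)..1, (w (t - δ * s) x + h * L q) = _root_.timeAvg δ w t x + h * L q := by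
    rw [intervalIntegral.integral_add hi (by simp)]
    simp [_root_.timeAvg]
  rw [← this]
  refine intervalIntegral.integral_mono_on zero_le_one (hw.intervalIntegrable hδ ht hxq)
    (hi.add (by simp)) fun s hs => ?_
  have := hw (t - δ * s) x q h hh hx hxq (by nlinarith [mul_nonneg hδ.le hs.1])
  rwa [sub_add_eq_add_sub] at this

theorem LineIneq.spaceAvg (hw : LineIneq L S w) (hc : Continuous fun q : ℝ × ℝ => w q.1 q.2)
    (hε : 0 < ε) : LineIneq L S (spaceAvg ε w) := by
  intro t x q h hh hx hxq ht
  have hi : ∀ t x, IntervalIntegrable (fun y => w t (x + ε * y)) MeasureTheory.volume 0 1 :=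
    fun t x => (hc.comp (by fun_prop : Continuous fun y : ℝ => (t, x + ε * y))).intervalIntegrable
      _ _
  have : ∫ y in (0 : ℝ)..1, (w t (x + ε * y) + h * L q) = _root_.spaceAvg ε w t x + h * L q := by
    rw [intervalIntegral.integral_add (hi t x) (by simp)]
    simp [_root_.spaceAvg]
  rw [← this]
  refine intervalIntegral.integral_mono_on zero_le_one (hi _ _)
    ((hi _ _).add (by simp)) fun y hy => ?_
  have hy' : 0 ≤ ε * y := mul_nonneg hε.le hy.1
  have := hw t (x + ε * y) q h hh (by linarith) (by linarith) ht
  rwa [add_right_comm] at this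

theorem LineIneq.continuousOn_timeAvg_left (hw : LineIneq L S w) (hδ : 0 < δ) {x : ℝ}
    (hx : 0 ≤ x) : ContinuousOn (fun t => _root_.timeAvg δ w t x) (Iic S) := by
  set k : ℝ → ℝ := fun s => w (min s S) x with hk
  have hki : ∀ a b, IntervalIntegrable k MeasureTheory.volume a b := by
    intro a b
    have ha : Antitone fun s => k s - min s S * L 0 := by
      intro s t hst
      simp only [hk]
      rcases (min_le_min_right S hst).eq_or_lt with h | h
      · rw [h]
      · linarith [hw.le_of_lt h (min_le_right _ _) hx]
    have hc : IntervalIntegrable (fun s => min s S * L 0) MeasureTheory.volume a b :=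
      Continuous.intervalIntegrable (by fun_prop) _ _
    simpa using ha.intervalIntegrable.add hc
  have hP : Continuous fun t => ∫ s in (0 : ℝ)..t, k s :=
    intervalIntegral.continuous_primitive hki 0
  have hF : Continuous fun t => δ⁻¹ * ((∫ s in (0 : ℝ)..t, k s) - ∫ s in (0 : ℝ)..(t - δ), k s) :=
    (hP.sub (hP.comp (continuous_id.sub continuous_const))).const_mul _
  refine hF.continuousOn.congr fun t ht => ?_
  have e : _root_.timeAvg δ w t x = ∫ s in (0 : ℝ)..1, k (t - δ * s) := by
    refine intervalIntegral.integral_congr fun s hs => ?_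
    rw [uIcc_of_le zero_le_one] at hs
    have : t - δ * s ≤ S := by nlinarith [mul_nonneg hδ.le hs.1, mem_Iic.1 ht]
    simp [hk, min_eq_left this]
  simp only [e]
  rw [intervalIntegral.integral_comp_sub_mul k hδ.ne' t,
    intervalIntegral.integral_interval_sub_left (hki _ _) (hki _ _)]
  simp

theorem LineIneq.continuousOn (hw : LineIneq L S w) (hL : Continuous L)
    (hc : ∀ x, 0 ≤ x → ContinuousOn (fun t => w t x) (Iic S)) :
    ContinuousOn (fun q : ℝ × ℝ => w q.1 q.2) (Iio S ×ˢ Ici 0) := by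
  obtain ⟨M, hM⟩ := (isCompact_Icc (a := (-1 : ℝ)) (b := 1)).exists_bound_of_continuousOn
    hL.continuousOn
  have hM0 : 0 ≤ M := (norm_nonneg _).trans (hM 0 (by simp))
  have hMk : ∀ {h k y : ℝ}, 0 < h → h ≤ k → k ≤ 3 * h → |y| ≤ h → k * L (y / k) ≤ 3 * h * M := by
    intro h k y hh hk hk' hy
    have hk0 : 0 < k := hh.trans_le hk
    have : |y / k| ≤ 1 := by
      rw [abs_div, abs_of_pos hk0, div_le_one hk0]; exact hy.trans hk
    have h1 : L (y / k) ≤ M := (le_abs_self _).trans (hM _ (abs_le.1 this))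
    calc k * L (y / k) ≤ k * M := by gcongr
      _ ≤ 3 * h * M := by gcongr
  rintro ⟨t₀, x₀⟩ ⟨ht₀, hx₀⟩
  simp only [mem_Iio, mem_Ici] at ht₀ hx₀
  rw [Metric.continuousWithinAt_iff]
  intro e he
  obtain ⟨r, hr, hr'⟩ := Metric.continuousWithinAt_iff.1 (hc x₀ hx₀ t₀ ht₀.le) (e / 2) (half_pos he)
  set h := min (min (r / 3) ((S - t₀) / 3)) (e / (6 * (M + 1))) with hh
  have h0 : 0 < h := by
    have : 0 < S - t₀ := sub_pos.2 ht₀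
    positivity
  have h1 : h ≤ r / 3 := (min_le_left _ _).trans (min_le_left _ _)
  have h2 : h ≤ (S - t₀) / 3 := (min_le_left _ _).trans (min_le_right _ _)
  have h3 : 3 * h * M < e / 2 := by
    have : h * (6 * (M + 1)) ≤ e := (le_div_iff₀ (by positivity)).1 (min_le_right _ _)
    nlinarith
  refine ⟨h, h0, ?_⟩
  rintro ⟨t, x⟩ ⟨ht, hx⟩ hd
  simp only [mem_Iio, mem_Ici] at ht hx
  simp only [Prod.dist_eq, max_lt_iff, Real.dist_eq] at hd
  obtain ⟨hd₁, hd₂⟩ := hd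
  obtain ⟨a₁, a₂⟩ := abs_lt.1 hd₁
  have b₁ := hr' (x := t₀ - 2 * h) (by simp; linarith)
    (by rw [Real.dist_eq, abs_lt]; constructor <;> linarith)
  have b₂ := hr' (x := t₀ + 2 * h) (by simp; linarith)
    (by rw [Real.dist_eq, abs_lt]; constructor <;> linarith)
  rw [Real.dist_eq, abs_lt] at b₁ b₂
  have c₁ := hw.le_of_lt' (s := t₀ - 2 * h) (t := t) (x := x₀) (y := x) (by linarith) ht.le hx₀ hx
  have c₂ := hw.le_of_lt' (s := t) (t := t₀ + 2 * h) (x := x) (y := x₀) (by linarith)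
    (by linarith) hx hx₀
  have d₁ := hMk (h := h) (k := t - (t₀ - 2 * h)) (y := x - x₀) h0 (by linarith) (by linarith)
    hd₂.le
  have d₂ := hMk (h := h) (k := t₀ + 2 * h - t) (y := x₀ - x) h0 (by linarith) (by linarith)
    (by rw [abs_sub_comm]; exact hd₂.le)
  simp only [Real.dist_eq, abs_lt]
  constructor <;> linarith [b₁.1, b₁.2, b₂.1, b₂.2]

/-- The time average of `w`, frozen after time `S₁` and extended by its value at the junction to
negative positions. -/
noncomputable def clampedAvg (δ S₁ : ℝ) (w : ℝ → ℝ → ℝ) (t x : ℝ) : ℝ :=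
  timeAvg δ w (min t S₁) (max x 0)

theorem LineIneq.continuous_clampedAvg {S₁ : ℝ} (hw : LineIneq L S w) (hL : Continuous L)
    (hδ : 0 < δ) (hS : S₁ < S) : Continuous fun q : ℝ × ℝ => clampedAvg δ S₁ w q.1 q.2 := by
  refine ((hw.timeAvg hδ).continuousOn hL
    fun x hx => hw.continuousOn_timeAvg_left hδ hx).comp_continuous
    (f := fun q : ℝ × ℝ => (min q.1 S₁, max q.2 0)) (by fun_prop) fun q => ?_
  exact ⟨(min_le_right _ _).trans_lt hS, le_max_right q.2 0⟩

theorem LineIneq.clampedAvg {S₁ : ℝ} (hw : LineIneq L S w) (hδ : 0 < δ) (hS : S₁ ≤ S) :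
    LineIneq L S₁ (clampedAvg δ S₁ w) := by
  intro t x q h hh hx hxq ht
  simp only [_root_.clampedAvg]
  rw [max_eq_left hx, max_eq_left hxq, min_eq_left ht, min_eq_left (by linarith)]
  exact hw.timeAvg hδ t x q h hh hx hxq (ht.trans hS)

/-- A differentiable function satisfying the line inequality is a classical subsolution. -/
theorem LineIneq.deriv_le {f : ℝ → ℝ → ℝ} (hf : LineIneq L S f) {t x a b : ℝ} (ht : t < S)
    (hx : 0 ≤ x) (hd : DifferentiableAt ℝ (fun q : ℝ × ℝ => f q.1 q.2) (t, x))
    (h₁ : HasDerivAt (fun s => f s x) a t) (h₂ : HasDerivAt (fun y => f t y) b x) (q : ℝ) :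
    a + q * b ≤ L q := by
  have key := ((hasDerivAt_along_line hd h₁ h₂ q).sub ((hasDerivAt_id (0 : ℝ)).mul_const (L q)))
  simp only [id, one_mul] at key
  rw [← sub_nonpos]
  rcases le_total 0 q with hq | hq
  · refine le_of_tendsto (hasDerivAt_iff_tendsto_slope.1 key |>.mono_left
      (nhdsWithin_mono (s := Ioi 0) _ fun y (hy : 0 < y) => hy.ne')) ?_
    filter_upwards [Ioo_mem_nhdsGT (sub_pos.2 ht)] with h hh
    have := hf t x q h hh.1 hx (add_nonneg hx (mul_nonneg hq hh.1.le)) (by linarith [hh.2])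
    rw [slope_def_field]
    refine div_nonpos_of_nonpos_of_nonneg ?_ (by linarith [hh.1])
    simp
    linarith
  · refine le_of_tendsto (hasDerivAt_iff_tendsto_slope.1 key |>.mono_left
      (nhdsWithin_mono (s := Iio 0) _ fun y (hy : y < 0) => hy.ne)) ?_
    filter_upwards [self_mem_nhdsWithin] with h hh
    have hh' : h < 0 := hh
    have := hf (t + h) (x + q * h) q (-h) (by linarith)
      (add_nonneg hx (mul_nonneg_of_nonpos_of_nonpos hq hh'.le)) (by simpa) (by linarith)
    rw [slope_def_field]
    refine div_nonpos_of_nonneg_of_nonpos ?_ (by linarith)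
    have e₁ : x + q * h + q * -h = x := by ring
    have e₂ : t + h + -h = t := by ring
    rw [e₁, e₂] at this
    simp
    linarith

end LineIneq

theorem spaceAvg_close {k : ℝ → ℝ → ℝ} (hk : Continuous fun q : ℝ × ℝ => k q.1 q.2)
    (a b R : ℝ) {ρ : ℝ} (hρ : 0 < ρ) :
    ∀ᶠ ε in nhdsWithin (0 : ℝ) (Ioi 0),
      ∀ t ∈ Icc a b, ∀ x ∈ Icc 0 R, |spaceAvg ε k t x - k t x| ≤ ρ := by
  have hu := (isCompact_Icc.prod isCompact_Icc).uniformContinuousOn_of_continuous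
    (s := Icc a b ×ˢ Icc 0 (R + 1)) hk.continuousOn
  obtain ⟨r, hr, hr'⟩ := Metric.uniformContinuousOn_iff.1 hu ρ hρ
  filter_upwards [Ioo_mem_nhdsGT (lt_min hr one_pos)] with ε hε t ht x hx
  have hε1 : ε < r := hε.2.trans_le (min_le_left _ _)
  have hε2 : ε < 1 := hε.2.trans_le (min_le_right _ _)
  have hi : IntervalIntegrable (fun y => k t (x + ε * y)) MeasureTheory.volume 0 1 :=
    (hk.comp (by fun_prop : Continuous fun y : ℝ => (t, x + ε * y))).intervalIntegrable _ _
  have e : spaceAvg ε k t x - k t x = ∫ y in (0 : ℝ)..1, (k t (x + ε * y) - k t x) := by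
    rw [intervalIntegral.integral_sub hi (by simp)]
    simp [spaceAvg]
  rw [e, ← Real.norm_eq_abs]
  refine (intervalIntegral.norm_integral_le_of_norm_le_const (C := ρ) fun y hy => ?_).trans
    (by simp)
  rw [uIoc_of_le zero_le_one] at hy
  have hy0 : 0 ≤ ε * y := mul_nonneg hε.1.le hy.1.le
  have hy1 : ε * y ≤ ε := by nlinarith [hy.2, hε.1]
  have := hr' (t, x + ε * y) ⟨ht, by simp only [mem_Icc]; constructor <;> linarith [hx.1, hx.2]⟩
    (t, x) ⟨ht, by simp only [mem_Icc]; constructor <;> linarith [hx.1, hx.2]⟩ (by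
      simp [Prod.dist_eq]
      exact ⟨hr, by rw [← abs_mul, abs_of_nonneg hy0]; linarith⟩)
  exact this.le

theorem spaceAvg_le_affine {k : ℝ → ℝ → ℝ} (hk : Continuous fun q : ℝ × ℝ => k q.1 q.2)
    {A B ε t x : ℝ} (hB : 0 ≤ B) (hε : 0 ≤ ε) (hx : 0 ≤ x)
    (h : ∀ y, 0 ≤ y → k t y ≤ A - B * y) : spaceAvg ε k t x ≤ A - B * x := by
  have hi : IntervalIntegrable (fun y => k t (x + ε * y)) MeasureTheory.volume 0 1 :=
    (hk.comp (by fun_prop : Continuous fun y : ℝ => (t, x + ε * y))).intervalIntegrable _ _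
  have : ∫ _ in (0 : ℝ)..1, (A - B * x) = A - B * x := by simp
  rw [← this]
  refine intervalIntegral.integral_mono_on zero_le_one hi (by simp) fun y hy => ?_
  have hy0 : 0 ≤ ε * y := mul_nonneg hε hy.1
  refine (h _ (add_nonneg hx hy0)).trans ?_
  nlinarith [mul_nonneg hB hy0]

/-- Functions satisfying the line inequality on each branch of the junction, with a common value
at the junction point, are approximated by `C¹` functions that are almost subsolutions. -/
theorem exists_smooth_approx {N : ℕ} {L : Fin N → ℝ → ℝ} {S S₁ δ ρ T R : ℝ}
    {w : Fin N → ℝ → ℝ → ℝ} (hw : ∀ α, LineIneq (L α) S (w α)) (hL : ∀ α, Continuous (L α))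
    (hw0 : ∀ α β t, w α t 0 = w β t 0) (hS : S₁ < S) (hδ : 0 < δ) (hρ : 0 < ρ) (hR : 0 ≤ R) :
    ∃ W Wt Wx : Fin N → ℝ → ℝ → ℝ,
      (∀ α, ContDiff ℝ 1 (fun q : ℝ × ℝ => W α q.1 q.2)) ∧
      (∀ α t x, HasDerivAt (fun s => W α s x) (Wt α t x) t) ∧
      (∀ α t x, HasDerivAt (fun y => W α t y) (Wx α t x) x) ∧
      (∀ α β t, W α t 0 = W β t 0) ∧
      (∀ α t x q, 0 ≤ t → t < S₁ → t ≤ T → 0 ≤ x → Wt α t x + q * Wx α t x ≤ L α q + ρ) ∧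
      (∀ α, ∀ t ∈ Icc 0 T, ∀ x ∈ Icc 0 R,
        |W α t x - timeAvg δ (clampedAvg δ S₁ (w α)) t x| ≤ ρ) ∧
      ∀ α, ∀ t ∈ Icc 0 T, ∀ A B, 0 ≤ B →
        (∀ y, 0 ≤ y → timeAvg δ (clampedAvg δ S₁ (w α)) t y ≤ A - B * y) →
        ∀ x, 0 ≤ x → W α t x ≤ A - B * x + ρ := by
  set f : Fin N → ℝ → ℝ → ℝ := fun α => clampedAvg δ S₁ (w α) with hf
  set F : Fin N → ℝ → ℝ → ℝ := fun α => timeAvg δ (f α) with hF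
  have hfc : ∀ α, Continuous fun q : ℝ × ℝ => f α q.1 q.2 := fun α =>
    (hw α).continuous_clampedAvg (hL α) hδ hS
  have hFc : ∀ α, Continuous fun q : ℝ × ℝ => F α q.1 q.2 := fun α => continuous_timeAvg (hfc α)
  have hF0 : ∀ α β t, F α t 0 = F β t 0 := by
    intro α β t
    simp only [hF, hf, timeAvg, clampedAvg, max_self, hw0 α β]
  obtain ⟨ε, hε, hε0⟩ := (((eventually_all.2 fun α => spaceAvg_close (hfc α) (-δ) T 0
    (half_pos (mul_pos hρ hδ))).and (eventually_all.2 fun α => spaceAvg_close (hFc α) 0 T R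
    (half_pos hρ))).and self_mem_nhdsWithin).exists
  obtain ⟨hεf, hεF⟩ := hε
  replace hε0 : 0 < ε := hε0
  set G : Fin N → ℝ → ℝ → ℝ := fun α => spaceAvg ε (F α) with hG
  have hG1 : ∀ α, ContDiff ℝ 1 (fun q : ℝ × ℝ => G α q.1 q.2) := fun α =>
    contDiff_spaceAvg_timeAvg (hfc α) hδ.ne' hε0.ne'
  have hGL : ∀ α, LineIneq (L α) S₁ (G α) := fun α =>
    (((hw α).clampedAvg hδ hS.le).timeAvg hδ).spaceAvg (hFc α) hε0
  have hGt := fun α => hasDerivAt_spaceAvg_timeAvg (ε := ε) (hfc α) hδ.ne'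
  have hGx := fun α => hasDerivAt_spaceAvg (hFc α) hε0.ne'
  have hFt := fun α => hasDerivAt_timeAvg (hfc α) hδ.ne'
  have hF1 : ∀ α, ContDiff ℝ 1 fun t => F α t 0 := by
    intro α
    rw [contDiff_one_iff_deriv]
    refine ⟨fun t => (hFt α t 0).differentiableAt, ?_⟩
    have : deriv (fun t => F α t 0) = fun t => (f α t 0 - f α (t - δ) 0) / δ :=
      funext fun t => (hFt α t 0).deriv
    rw [this]
    exact (((hfc α).comp (by fun_prop : Continuous fun t : ℝ => (t, (0 : ℝ)))).sub ((hfc α).comp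
      (by fun_prop : Continuous fun t : ℝ => (t - δ, (0 : ℝ))))).div_const _
  refine ⟨fun α t x => G α t x + (F α t 0 - G α t 0), _, _, fun α => ?_,
    fun α t x => (hGt α t x).add ((hFt α t 0).sub (hGt α t 0)),
    fun α t x => (hGx α t x).add_const _, fun α β t => ?_, fun α t x q ht ht1 htT hx => ?_,
    fun α t ht x hx => ?_, fun α t ht A B hB h x hx => ?_⟩
  · exact (hG1 α).add (((hF1 α).comp contDiff_fst).sub
      ((hG1 α).comp (contDiff_fst.prodMk contDiff_const)))
  · simp [hF0 α β]
  · have h1 := (hGL α).deriv_le ht1 hx ((hG1 α).differentiable one_ne_zero _) (hGt α t x)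
      (hGx α t x) q
    have h2 := abs_le.1 (hεf α t ⟨by linarith, htT⟩ 0 ⟨le_rfl, le_rfl⟩)
    have h3 := abs_le.1 (hεf α (t - δ) ⟨by linarith, by linarith⟩ 0 ⟨le_rfl, le_rfl⟩)
    have h4 : (f α t 0 - f α (t - δ) 0) / δ -
        (spaceAvg ε (f α) t 0 - spaceAvg ε (f α) (t - δ) 0) / δ ≤ ρ := by
      rw [← sub_div, div_le_iff₀ hδ]
      linarith [h2.1, h3.2]
    linarith
  · have h1 := abs_le.1 (hεF α t ht x hx)
    have h2 := abs_le.1 (hεF α t ht 0 ⟨le_rfl, hR⟩)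
    rw [abs_le]
    constructor <;> simp only [hG] <;> linarith [h1.1, h1.2, h2.1, h2.2]
  · have h1 := spaceAvg_le_affine (hFc α) hB hε0.le hx h
    have h2 := abs_le.1 (hεF α t ht 0 ⟨le_rfl, hR⟩)
    simp only [hG]
    linarith [h2.1]

theorem exists_positive_max {N : ℕ} {T a b R : ℝ} {Ψ : Fin N → ℝ → ℝ → ℝ}
    (hΨ : ∀ β, UpperSemicontinuousOn (fun q : ℝ × ℝ => Ψ β q.1 q.2) (Icc a b ×ˢ Icc 0 R))
    (hpos : ∀ β t z, t ∈ Ioo 0 T → 0 ≤ z → 0 < Ψ β t z → t ∈ Icc a b ∧ z ≤ R)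
    (ha : ∀ β z, 0 ≤ z → z ≤ R → Ψ β a z ≤ 0)
    (hex : ∃ β t z, t ∈ Ioo 0 T ∧ 0 ≤ z ∧ 0 < Ψ β t z) :
    ∃ β t z, a < t ∧ t ≤ b ∧ 0 ≤ z ∧ 0 < Ψ β t z ∧
      ∀ β' t' z', t' ∈ Ioo 0 T → 0 ≤ z' → Ψ β' t' z' ≤ Ψ β t z := by
  obtain ⟨β₁, t₁, z₁, ht₁, hz₁, h₁⟩ := hex
  have hmem : ∀ {β t z}, t ∈ Ioo 0 T → 0 ≤ z → 0 < Ψ β t z →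
      (t, z) ∈ Icc a b ×ˢ Icc (0 : ℝ) R := fun ht hz h =>
    ⟨(hpos _ _ _ ht hz h).1, hz, (hpos _ _ _ ht hz h).2⟩
  choose P hPm hP using fun β => (hΨ β).exists_isMaxOn ⟨_, hmem ht₁ hz₁ h₁⟩
    (isCompact_Icc.prod isCompact_Icc)
  have : Nonempty (Fin N) := ⟨β₁⟩
  obtain ⟨β, hβ⟩ := Finite.exists_max fun β => Ψ β (P β).1 (P β).2
  have hle : ∀ β' t z, (t, z) ∈ Icc a b ×ˢ Icc (0 : ℝ) R → Ψ β' t z ≤ Ψ β (P β).1 (P β).2 :=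
    fun β' t z h => (hP β' h).trans (hβ β')
  have h0 : 0 < Ψ β (P β).1 (P β).2 := h₁.trans_le (hle _ _ _ (hmem ht₁ hz₁ h₁))
  obtain ⟨⟨hm₁, hm₂⟩, hm₃, hm₄⟩ := hPm β
  refine ⟨β, (P β).1, (P β).2, lt_of_le_of_ne hm₁ ?_, hm₂, hm₃, h0, fun β' t' z' ht' hz' => ?_⟩
  · intro h
    rw [← h] at h0
    exact h0.not_ge (ha _ _ hm₃ hm₄)
  · rcases le_or_gt (Ψ β' t' z') 0 with h | h
    · exact h.trans h0.le
    · exact hle _ _ _ (hmem ht' hz' h)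

section Touching

variable {N : ℕ} {T a b R : ℝ} {H : Fin N → ℝ → ℝ} {p₀ : Fin N → ℝ}
  {u φ φt φx : Fin N → ℝ → ℝ → ℝ}

theorem IsViscSubSol.exists_touching (hu : IsViscSubSol T H p₀ u)
    (hφ : ∀ α, ContDiff ℝ 1 (fun q : ℝ × ℝ => φ α q.1 q.2))
    (ht : ∀ α t x, HasDerivAt (fun s => φ α s x) (φt α t x) t)
    (hx : ∀ α t x, HasDerivAt (fun y => φ α t y) (φx α t x) x)
    (h0 : ∀ α β t, φ α t 0 = φ β t 0) (ha0 : 0 ≤ a) (hb : b < T)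
    (hpos : ∀ β t z, t ∈ Ioo 0 T → 0 ≤ z → φ β t z < u β t z → t ∈ Icc a b ∧ z ≤ R)
    (ha : ∀ β z, 0 ≤ z → z ≤ R → u β a z ≤ φ β a z)
    (hex : ∃ β t z, t ∈ Ioo 0 T ∧ 0 ≤ z ∧ φ β t z < u β t z) :
    ∃ β t z, a < t ∧ t ≤ b ∧ 0 ≤ z ∧ φ β t z < u β t z ∧
      (0 < z → φt β t z + H β (φx β t z) ≤ 0) ∧
      (z = 0 → φt β t 0 + sSup (Set.range fun γ => Hm (H γ) (p₀ γ) (φx γ t 0)) ≤ 0) := by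
  obtain ⟨β, t, z, h1, h2, h3, h4, h5⟩ := exists_positive_max (T := T) (a := a) (b := b) (R := R)
    (Ψ := fun β t z => u β t z - φ β t z) (fun β => by
      simp only [sub_eq_add_neg]
      have hn : Continuous fun q : ℝ × ℝ => -φ β q.1 q.2 := (hφ β).continuous.neg
      exact UpperSemicontinuousOn.add ((hu.1 β).mono
        (prod_mono (fun t ht => ⟨ha0.trans ht.1, ht.2.trans_lt hb⟩) fun z hz => hz.1))
        (hn.upperSemicontinuous.upperSemicontinuousOn _))
    (fun β t z ht hz h => hpos β t z ht hz (sub_pos.1 h))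
    (fun β z hz hz' => sub_nonpos.2 (ha β z hz hz'))
    (by obtain ⟨β, t, z, ht, hz, h⟩ := hex; exact ⟨β, t, z, ht, hz, sub_pos.2 h⟩)
  have htT : t ∈ Ioo 0 T := ⟨ha0.trans_lt h1, h2.trans_lt hb⟩
  set c := u β t z - φ β t z with hc
  obtain ⟨k₁, k₂⟩ := hu.2.2 (fun α t x => φ α t x + c)
    (fun α => ((hφ α).add contDiff_const).contDiffOn) (fun α β t => by simp [h0 α β])
    (fun β' t' x' ht' hx' => by linarith [h5 β' t' x' ht' hx'])
  have dt : ∀ α t x, deriv (fun s => φ α s x + c) t = φt α t x := fun α t x =>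
    ((ht α t x).add_const c).deriv
  have dx : ∀ α t x, 0 ≤ x → derivWithin (fun y => φ α t y + c) (Ici 0) x = φx α t x :=
    fun α t x h => (((hx α t x).add_const c).hasDerivWithinAt).derivWithin
      (uniqueDiffOn_Ici 0 x h)
  simp only [dt] at k₁ k₂
  refine ⟨β, t, z, h1, h2, h3, sub_pos.1 h4, fun hz => ?_, fun hz => ?_⟩
  · have := k₁ β t z htT hz (by simp [hc])
    rwa [dx _ _ _ h3] at this
  · subst hz
    have := k₂ t htT (fun α => by rw [hu.2.1 α β, h0 α β]; simp [hc]) β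
    simpa only [dx _ _ _ le_rfl] using this

theorem IsViscSuperSol.exists_touching (hu : IsViscSuperSol T H p₀ u)
    (hφ : ∀ α, ContDiff ℝ 1 (fun q : ℝ × ℝ => φ α q.1 q.2))
    (ht : ∀ α t x, HasDerivAt (fun s => φ α s x) (φt α t x) t)
    (hx : ∀ α t x, HasDerivAt (fun y => φ α t y) (φx α t x) x)
    (h0 : ∀ α β t, φ α t 0 = φ β t 0) (ha0 : 0 ≤ a) (hb : b < T)
    (hpos : ∀ β t z, t ∈ Ioo 0 T → 0 ≤ z → u β t z < φ β t z → t ∈ Icc a b ∧ z ≤ R)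
    (ha : ∀ β z, 0 ≤ z → z ≤ R → φ β a z ≤ u β a z)
    (hex : ∃ β t z, t ∈ Ioo 0 T ∧ 0 ≤ z ∧ u β t z < φ β t z) :
    ∃ β t z, a < t ∧ t ≤ b ∧ 0 ≤ z ∧ u β t z < φ β t z ∧
      (0 < z → 0 ≤ φt β t z + H β (φx β t z)) ∧
      (z = 0 → 0 ≤ φt β t 0 + sSup (Set.range fun γ => Hm (H γ) (p₀ γ) (φx γ t 0))) := by
  obtain ⟨β, t, z, h1, h2, h3, h4, h5⟩ := exists_positive_max (T := T) (a := a) (b := b) (R := R)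
    (Ψ := fun β t z => φ β t z - u β t z) (fun β => by
      simp only [sub_eq_add_neg]
      refine UpperSemicontinuousOn.add
        ((hφ β).continuous.upperSemicontinuous.upperSemicontinuousOn _) ?_
      intro q hq y hy
      have := (hu.1 β) q ⟨⟨ha0.trans hq.1.1, hq.1.2.trans_lt hb⟩, hq.2.1⟩ (-y) (by linarith)
      filter_upwards [nhdsWithin_mono q (prod_mono (fun t (ht : t ∈ Icc a b) =>
        (⟨ha0.trans ht.1, ht.2.trans_lt hb⟩ : t ∈ Ico 0 T))
        fun z (hz : z ∈ Icc 0 R) => (hz.1 : z ∈ Ici 0)) this] with p hp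
      have hp' : -y < u β p.1 p.2 := hp
      linarith)
    (fun β t z ht hz h => hpos β t z ht hz (sub_pos.1 h))
    (fun β z hz hz' => sub_nonpos.2 (ha β z hz hz'))
    (by obtain ⟨β, t, z, ht, hz, h⟩ := hex; exact ⟨β, t, z, ht, hz, sub_pos.2 h⟩)
  have htT : t ∈ Ioo 0 T := ⟨ha0.trans_lt h1, h2.trans_lt hb⟩
  set c := φ β t z - u β t z with hc
  obtain ⟨k₁, k₂⟩ := hu.2.2 (fun α t x => φ α t x - c)
    (fun α => ((hφ α).sub contDiff_const).contDiffOn) (fun α β t => by simp [h0 α β])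
    (fun β' t' x' ht' hx' => by linarith [h5 β' t' x' ht' hx'])
  have dt : ∀ α t x, deriv (fun s => φ α s x - c) t = φt α t x := fun α t x =>
    ((ht α t x).sub_const c).deriv
  have dx : ∀ α t x, 0 ≤ x → derivWithin (fun y => φ α t y - c) (Ici 0) x = φx α t x :=
    fun α t x h => (((hx α t x).sub_const c).hasDerivWithinAt).derivWithin
      (uniqueDiffOn_Ici 0 x h)
  simp only [dt] at k₁ k₂
  refine ⟨β, t, z, h1, h2, h3, sub_pos.1 h4, fun hz => ?_, fun hz => ?_⟩
  · have := k₁ β t z htT hz (by simp [hc])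
    rwa [dx _ _ _ h3] at this
  · subst hz
    have := k₂ t htT (fun α => by rw [hu.2.1 α β, h0 α β]; simp [hc]) β
    simpa only [dx _ _ _ le_rfl] using this

end Touching

theorem hasDerivAt_max_zero_sq (t : ℝ) : HasDerivAt (fun s : ℝ => max s 0 ^ 2) (2 * max t 0) t := by
  rcases lt_trichotomy t 0 with h | rfl | h
  · rw [max_eq_right h.le, mul_zero]
    refine (hasDerivAt_const t (0 : ℝ)).congr_of_eventuallyEq ?_
    filter_upwards [Iio_mem_nhds h] with s hs
    simp [max_eq_right (mem_Iio.1 hs).le]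
  · rw [max_self, mul_zero, hasDerivAt_iff_isLittleO_nhds_zero]
    simp only [zero_add, max_self, smul_zero, sub_zero, ne_eq, OfNat.ofNat_ne_zero,
      not_false_eq_true, zero_pow]
    refine Asymptotics.IsBigO.trans_isLittleO (g := fun s : ℝ => s ^ 2) ?_ ?_
    · refine Asymptotics.IsBigO.of_bound 1 (Eventually.of_forall fun s => ?_)
      rw [one_mul, norm_pow, norm_pow]
      gcongr
      rcases le_total s 0 with h | h
      · simp [max_eq_right h]
      · simp [max_eq_left h]
    · simpa using Asymptotics.isLittleO_pow_id (𝕜 := ℝ) one_lt_two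
  · rw [max_eq_left h.le]
    have : HasDerivAt (fun s : ℝ => s ^ 2) (2 * t) t := by simpa using hasDerivAt_pow 2 t
    refine this.congr_of_eventuallyEq ?_
    filter_upwards [Ioi_mem_nhds h] with s hs
    rw [max_eq_left (mem_Ioi.1 hs).le]

theorem contDiff_max_zero_sq : ContDiff ℝ 1 fun s : ℝ => max s 0 ^ 2 := by
  rw [contDiff_one_iff_deriv]
  refine ⟨fun t => (hasDerivAt_max_zero_sq t).differentiableAt, ?_⟩
  rw [show deriv (fun s : ℝ => max s 0 ^ 2) = fun t => 2 * max t 0 from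
    funext fun t => (hasDerivAt_max_zero_sq t).deriv]
  fun_prop

theorem bddAbove_range_mul_sub {L : ℝ → ℝ} {γ : ℝ} (hγ : 0 < γ) (hL : ContDiff ℝ 2 L)
    (h : ∀ q, γ ≤ deriv (deriv L) q) (p : ℝ) : BddAbove (Set.range fun q => p * q - L q) := by
  have hd : Differentiable ℝ L := hL.differentiable (by norm_num)
  have hd' : Differentiable ℝ (deriv L) := by
    have : ContDiff ℝ 1 (deriv L) := by
      have := (contDiff_succ_iff_deriv (n := 1)).1 (by simpa [one_add_one_eq_two] using hL)
      exact this.2.2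
    exact this.differentiable (by norm_num)
  set a := deriv L 0 with ha
  have hm : Monotone fun q => deriv L q - γ * q := by
    refine monotone_of_deriv_nonneg (by fun_prop) fun q => ?_
    have : HasDerivAt (fun q => deriv L q - γ * q) (deriv (deriv L) q - γ * 1) q :=
      (hd' q).hasDerivAt.sub ((hasDerivAt_id q).const_mul γ)
    rw [this.deriv]
    linarith [h q]
  have hg : ∀ q, HasDerivAt (fun q => L q - γ / 2 * q ^ 2) (deriv L q - γ * q) q := fun q => by
    refine ((hd q).hasDerivAt.sub ((hasDerivAt_pow 2 q).const_mul (γ / 2))).congr_deriv ?_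
    simp; ring
  have hconv : ConvexOn ℝ univ fun q => L q - γ / 2 * q ^ 2 := by
    refine Monotone.convexOn_univ_of_deriv (fun q => (hg q).differentiableAt) ?_
    rwa [show deriv (fun q => L q - γ / 2 * q ^ 2) = fun q => deriv L q - γ * q from
      funext fun q => (hg q).deriv]
  have key : ∀ q, L 0 + a * q + γ / 2 * q ^ 2 ≤ L q := by
    intro q
    have h0 := hg 0
    simp only [mul_zero, sub_zero] at h0
    rcases lt_trichotomy q 0 with hq | rfl | hq
    · have := hconv.slope_le_of_hasDerivAt (mem_univ q) (mem_univ 0) hq h0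
      rw [slope_def_field, div_le_iff₀ (by linarith)] at this
      norm_num at this
      linarith
    · simp
    · have := hconv.le_slope_of_hasDerivAt (mem_univ 0) (mem_univ q) hq h0
      rw [slope_def_field, le_div_iff₀ (by linarith)] at this
      norm_num at this
      linarith
  refine ⟨(p - a) ^ 2 / (2 * γ) - L 0, ?_⟩
  rintro _ ⟨q, rfl⟩
  have e : (p - a) ^ 2 / (2 * γ) - (p - a) * q + γ / 2 * q ^ 2 = (p - a - γ * q) ^ 2 / (2 * γ) := by
    field_simp; ring
  have : 0 ≤ (p - a - γ * q) ^ 2 / (2 * γ) := by positivity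
  linarith [key q]

/-- The part of the convex duality between Hamiltonians and Lagrangians used for comparison. -/
structure IsDual {N : ℕ} (H : Fin N → ℝ → ℝ) (p₀ : Fin N → ℝ) (L : Fin N → ℝ → ℝ) : Prop where
  continuous : ∀ α, Continuous (L α)
  le_H : ∀ α p q, p * q - L α q ≤ H α p
  le_Hm : ∀ α p q, q ≤ 0 → p * q - L α q ≤ Hm (H α) (p₀ α) p
  H_le : ∀ α p c, (∀ q, p * q - L α q ≤ c) → H α p ≤ c
  Hm_le : ∀ α p c, (∀ q, p * q - L α q ≤ c) → Hm (H α) (p₀ α) p ≤ c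

theorem A1primeCond.exists_isDual {N : ℕ} {H : Fin N → ℝ → ℝ} {p₀ : Fin N → ℝ}
    (h : A1primeCond H p₀) : ∃ L, IsDual H p₀ L := by
  obtain ⟨γ, L, hγ, hL, hL', hH, hHm, -⟩ := h
  have hb := fun α => bddAbove_range_mul_sub hγ (hL α) (hL' α)
  refine ⟨L, fun α => (hL α).continuous, fun α p q => ?_, fun α p q hq => ?_, fun α p c hc => ?_,
    fun α p c hc => ?_⟩
  · rw [hH]
    exact le_csSup (hb α p) (mem_range_self q)
  · rw [hHm]
    exact le_csSup ((hb α p).mono (image_subset_range _ _)) (mem_image_of_mem _ hq)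
  · rw [hH]
    exact csSup_le (range_nonempty _) (by rintro _ ⟨q, rfl⟩; exact hc q)
  · rw [hHm]
    exact csSup_le (nonempty_Iic.image _) (by rintro _ ⟨q, -, rfl⟩; exact hc q)

section LineInequality

variable {N : ℕ} {T C : ℝ} {H L : Fin N → ℝ → ℝ} {p₀ : Fin N → ℝ} {u : Fin N → ℝ → ℝ → ℝ}

set_option maxHeartbeats 2000000 in
theorem IsViscSubSol.le_add_mul_of_pos (hu : IsViscSubSol T H p₀ u) (hd : IsDual H p₀ L)
    (hH : ∀ α, Tendsto (H α) atTop atTop) (hC : 0 < C)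
    (hub : ∀ (α : Fin N) (t x : ℝ), t ∈ Ico 0 T → 0 ≤ x → u α t x ≤ C * (1 + x))
    {α : Fin N} {t₀ h x q : ℝ} (ht₀ : 0 < t₀) (hh : 0 < h) (hx : 0 < x) (hxq : 0 ≤ x + q * h)
    (hT : t₀ + h < T) : u α (t₀ + h) (x + q * h) ≤ u α t₀ x + h * L α q := by
  by_contra! hcon
  obtain ⟨g, hg⟩ : ∃ g, g = u α (t₀ + h) (x + q * h) - (u α t₀ x + h * L α q) := ⟨_, rfl⟩
  have hg0 : 0 < g := by linarith
  obtain ⟨U, hU⟩ : ∃ U, U = u α t₀ x := ⟨_, rfl⟩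
  obtain ⟨l, hl⟩ : ∃ l, l = L α q := ⟨_, rfl⟩
  obtain ⟨t₁, ht₁⟩ : ∃ t₁, t₁ = t₀ + h := ⟨_, rfl⟩
  obtain ⟨σ, hσ⟩ : ∃ σ, σ = g / 4 := ⟨_, rfl⟩
  obtain ⟨η, hη⟩ : ∃ η, η = g / (4 * h) := ⟨_, rfl⟩
  have hσ0 : 0 < σ := by rw [hσ]; positivity
  have hη0 : 0 < η := by rw [hη]; positivity
  have hηh : η * h = g / 4 := by rw [hη]; field_simp
  rw [← hU, ← hl] at hg
  have hT0 : 0 < T := by linarith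
  -- a neighbourhood of `(t₀, x)` on which `u α` is controlled by semicontinuity
  obtain ⟨r, hr0, hrσ, hr⟩ : ∃ r > 0, (|l| + η) * r ≤ σ / 2 ∧ ∀ t z, 0 ≤ z → t ∈ Ico 0 T →
      |t - t₀| < r → |z - x| < r → u α t z < U + σ / 2 := by
    have := hu.1 α (t₀, x) ⟨⟨ht₀.le, by linarith⟩, hx.le⟩ (U + σ / 2) (by simp only; linarith)
    obtain ⟨r, hr, hsub⟩ := Metric.mem_nhdsWithin_iff.1 this
    have hp : 0 < |l| + η := by positivity
    refine ⟨min r (σ / (2 * (|l| + η))), lt_min hr (by positivity), ?_, fun t z hz ht h₁ h₂ => ?_⟩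
    · calc (|l| + η) * _ ≤ (|l| + η) * (σ / (2 * (|l| + η))) := by gcongr; exact min_le_right _ _
        _ = σ / 2 := by field_simp
    · refine hsub (a := (t, z)) ⟨?_, ht, hz⟩
      rw [Metric.mem_ball, Prod.dist_eq, max_lt_iff, Real.dist_eq, Real.dist_eq]
      exact ⟨h₁.trans_le (min_le_left _ _), h₂.trans_le (min_le_left _ _)⟩
  obtain ⟨T', hT'⟩ : ∃ T', T' = (t₁ + T) / 2 := ⟨_, rfl⟩
  have hq1 : 0 < 1 + |q| := by positivity
  obtain ⟨s, hs0, hsr, hsx, hsT⟩ : ∃ s > 0, s * (1 + |q|) ≤ r ∧ s * (1 + |q|) ≤ x ∧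
      s ≤ T' - t₁ := by
    refine ⟨min (min (r / (1 + |q|)) (x / (1 + |q|))) (T' - t₁), ?_, ?_, ?_, min_le_right _ _⟩
    · exact lt_min (lt_min (by positivity) (by positivity)) (by linarith)
    · rw [← le_div_iff₀ hq1]; exact (min_le_left _ _).trans (min_le_left _ _)
    · rw [← le_div_iff₀ hq1]; exact (min_le_left _ _).trans (min_le_right _ _)
  have hqs : 0 ≤ |q| * s := by positivity
  obtain ⟨k, hk⟩ : ∃ k, k = C * (2 + x + |q| * T) + |U| + (|l| + η) * T := ⟨_, rfl⟩
  have hk0 : 0 ≤ k := by rw [hk]; positivity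
  obtain ⟨n, hn⟩ : ∃ n, n = C + k / s ^ 2 := ⟨_, rfl⟩
  have hn0 : 0 ≤ n := by rw [hn]; positivity
  have hl1 : -|l| ≤ l := neg_abs_le l
  set X : ℝ → ℝ := fun t => x + q * (t - t₀) with hX
  set D : ℝ → ℝ → ℝ := fun t z =>
    (z - X t) ^ 2 + max (t₀ - t) 0 ^ 2 + max (t - t₁) 0 ^ 2 with hD
  set Φ : ℝ → ℝ → ℝ := fun t z => U + σ + (l + η) * (t - t₀) + n * D t z with hΦ
  set Φt : ℝ → ℝ → ℝ := fun t z =>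
    l + η + n * (-(2 * q * (z - X t)) - 2 * max (t₀ - t) 0 + 2 * max (t - t₁) 0) with hΦt
  set Φx : ℝ → ℝ → ℝ := fun t z => n * (2 * (z - X t)) with hΦx
  have hD0 : ∀ t z, 0 ≤ D t z := fun t z => by positivity
  have hXbd : ∀ t ∈ Ioo 0 T, |X t| ≤ x + |q| * T := by
    intro t ht
    have h1 : |t - t₀| ≤ T := abs_le.2 ⟨by linarith [ht.1], by linarith [ht.2]⟩
    calc |X t| ≤ |x| + |q * (t - t₀)| := abs_add_le _ _
      _ ≤ x + |q| * T := by rw [abs_mul, abs_of_pos hx]; gcongr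
  have hlin : ∀ t ∈ Ioo 0 T, -((|l| + η) * T) ≤ (l + η) * (t - t₀) := by
    intro t ht
    have h1 : |t - t₀| ≤ T := abs_le.2 ⟨by linarith [ht.1], by linarith [ht.2]⟩
    have h2 : |(l + η) * (t - t₀)| ≤ (|l| + η) * T := by
      rw [abs_mul]
      gcongr
      exact (abs_add_le _ _).trans (by rw [abs_of_pos hη0])
    linarith [neg_abs_le ((l + η) * (t - t₀))]
  have hDs : ∀ t ∈ Ioo 0 T, ∀ z, 0 ≤ z → Φ t z < C * (1 + z) → D t z < s ^ 2 := by
    intro t ht z hz hlt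
    by_contra! hge
    have h1 : k ≤ k / s ^ 2 * D t z := by
      rw [div_mul_eq_mul_div, le_div_iff₀ (by positivity)]
      gcongr
    have h2 : n * D t z = C * D t z + k / s ^ 2 * D t z := by rw [hn]; ring
    have h3 : z ≤ x + |q| * T + 1 + D t z := by
      have h4 : (z - X t) ^ 2 ≤ D t z := by
        have : 0 ≤ max (t₀ - t) 0 ^ 2 + max (t - t₁) 0 ^ 2 := by positivity
        simp only [hD]; linarith
      have h5 : z - X t ≤ 1 + (z - X t) ^ 2 := by nlinarith only [sq_nonneg (z - X t - 1)]
      linarith only [h4, h5, hXbd t ht, le_abs_self (X t)]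
    have h5 := mul_le_mul_of_nonneg_left h3 hC.le
    have h6 := hlin t ht
    have h7 := neg_abs_le U
    simp only [hΦ] at hlt
    linarith
  have hDlt : ∀ t z, D t z < s ^ 2 → |z - X t| < s ∧ t₀ - t < s ∧ t - t₁ < s := by
    intro t z hlt
    have h1 := sq_nonneg (z - X t)
    have h2 := sq_nonneg (max (t₀ - t) 0)
    have h3 := sq_nonneg (max (t - t₁) 0)
    simp only [hD] at hlt
    refine ⟨abs_lt_of_sq_lt_sq (by linarith) hs0.le, ?_, ?_⟩
    · exact (le_max_left _ _).trans_lt (lt_of_pow_lt_pow_left₀ 2 hs0.le (by linarith))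
    · exact (le_max_left _ _).trans_lt (lt_of_pow_lt_pow_left₀ 2 hs0.le (by linarith))
  have hXx : ∀ t, t₀ - t < s → t ≤ t₀ → |X t - x| ≤ |q| * s := by
    intro t h1 h2
    have : |t - t₀| ≤ s := abs_le.2 ⟨by linarith, by linarith⟩
    simp only [hX, add_sub_cancel_left, abs_mul]
    gcongr
  have hzero : ∀ t, D t 0 < s ^ 2 → t₀ < t := by
    intro t hlt
    by_contra! hle
    obtain ⟨h1, h2, -⟩ := hDlt t 0 hlt
    have h3 := hXx t h2 hle
    rw [abs_lt] at h1
    rw [abs_le] at h3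
    linarith
  obtain ⟨E, hE⟩ := (isCompact_Icc (a := t₀) (b := T')).exists_bound_of_continuousOn
    (f := fun t => Φt t 0) (Continuous.continuousOn (by simp only [hΦt, hX]; fun_prop))
  obtain ⟨B, hBC, hBE⟩ : ∃ B, C + 1 ≤ B ∧ ∀ β, E < H β B :=
    ((eventually_ge_atTop (C + 1)).and
      (eventually_all.2 fun β => (hH β).eventually_gt_atTop E)).exists
  set φ : Fin N → ℝ → ℝ → ℝ := fun β t z => if β = α then Φ t z else Φ t 0 + B * z with hφ
  set φt : Fin N → ℝ → ℝ → ℝ := fun β t z => if β = α then Φt t z else Φt t 0 with hφt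
  set φx : Fin N → ℝ → ℝ → ℝ := fun β t z => if β = α then Φx t z else B with hφx
  have hφ0 : ∀ β t, φ β t 0 = Φ t 0 := fun β t => by simp only [hφ]; split_ifs <;> simp
  have hΦc : ContDiff ℝ 1 fun p : ℝ × ℝ => Φ p.1 p.2 := by
    have e1 : ContDiff ℝ 1 fun p : ℝ × ℝ => max (t₀ - p.1) 0 ^ 2 :=
      contDiff_max_zero_sq.comp (by fun_prop : ContDiff ℝ 1 fun p : ℝ × ℝ => t₀ - p.1)
    have e2 : ContDiff ℝ 1 fun p : ℝ × ℝ => max (p.1 - t₁) 0 ^ 2 :=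
      contDiff_max_zero_sq.comp (by fun_prop : ContDiff ℝ 1 fun p : ℝ × ℝ => p.1 - t₁)
    simp only [hΦ, hD, hX]
    fun_prop
  have hsq : ∀ y : ℝ, HasDerivAt (fun y => y ^ 2) (2 * y) y := fun y => by
    simpa using hasDerivAt_pow 2 y
  have hΦdt : ∀ t z, HasDerivAt (fun t => Φ t z) (Φt t z) t := by
    intro t z
    have e0 : HasDerivAt (fun t => (z - X t) ^ 2) (2 * (z - X t) * (-q)) t := by
      have : HasDerivAt (fun t => z - X t) (-q) t := by
        simpa using ((((hasDerivAt_id t).sub_const t₀).const_mul q).const_add x).const_sub z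
      exact (hsq (z - X t)).comp t this
    have e1 : HasDerivAt (fun t => max (t₀ - t) 0 ^ 2) (2 * max (t₀ - t) 0 * (-1)) t :=
      (hasDerivAt_max_zero_sq (t₀ - t)).comp t ((hasDerivAt_id t).const_sub t₀)
    have e2 : HasDerivAt (fun t => max (t - t₁) 0 ^ 2) (2 * max (t - t₁) 0 * 1) t := by
      have : HasDerivAt (fun t => t - t₁) 1 t := (hasDerivAt_id t).sub_const t₁
      exact (hasDerivAt_max_zero_sq (t - t₁)).comp t this
    have e3 : HasDerivAt (fun t => U + σ + (l + η) * (t - t₀)) ((l + η) * 1) t :=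
      (((hasDerivAt_id t).sub_const t₀).const_mul (l + η)).const_add (U + σ)
    refine (e3.add (((e0.add e1).add e2).const_mul n)).congr_deriv ?_
    simp only [hΦt]; ring
  have hΦdx : ∀ t z, HasDerivAt (fun z => Φ t z) (Φx t z) z := by
    intro t z
    have e0 : HasDerivAt (fun z => (z - X t) ^ 2) (2 * (z - X t) * 1) z := by
      have : HasDerivAt (fun z => z - X t) 1 z := (hasDerivAt_id z).sub_const (X t)
      exact (hsq (z - X t)).comp z this
    rw [mul_one] at e0
    exact (((e0.add_const _).add_const _).const_mul n).const_add _
  have hpos : ∀ β t z, t ∈ Ioo 0 T → 0 ≤ z → φ β t z < u β t z →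
      t₀ < t ∧ t ≤ T' ∧ z ≤ C + |U| + (|l| + η) * T + x + |q| * T + s := by
    intro β t z ht hz hlt
    have hlt' := hlt.trans_le (hub β t z ⟨ht.1.le, ht.2⟩ hz)
    have hU0 := abs_nonneg U
    have hl0 : 0 ≤ (|l| + η) * T := by positivity
    have hqT : 0 ≤ |q| * T := by positivity
    simp only [hφ] at hlt hlt'
    split_ifs at hlt hlt' with hβ
    · subst hβ
      obtain ⟨h1, h2, h3⟩ := hDlt t z (hDs t ht z hz hlt')
      refine ⟨?_, by linarith, ?_⟩
      · by_contra! hle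
        have h4 := hXx t h2 hle
        have h5 : |z - x| < r := by
          have := abs_sub_le z (X t) x
          linarith
        have h6 : |t - t₀| < r := by
          rw [abs_lt]; constructor <;> linarith
        have h7 := hr t z hz ⟨ht.1.le, ht.2⟩ h6 h5
        have h8 : -((|l| + η) * r) ≤ (l + η) * (t - t₀) := by
          have : |(l + η) * (t - t₀)| ≤ (|l| + η) * r := by
            rw [abs_mul]
            gcongr
            exact (abs_add_le _ _).trans (by rw [abs_of_pos hη0])
          linarith [neg_abs_le ((l + η) * (t - t₀))]
        have h9 : 0 ≤ n * D t z := mul_nonneg hn0 (hD0 t z)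
        simp only [hΦ] at hlt
        linarith
      · have h4 := (abs_lt.1 h1).2
        have h5 := (le_abs_self _).trans (hXbd t ht)
        linarith
    · have hlt0 : Φ t 0 < C * (1 + 0) := by nlinarith
      have hD1 := hDs t ht 0 le_rfl hlt0
      obtain ⟨h1, h2, h3⟩ := hDlt t 0 hD1
      refine ⟨hzero t hD1, by linarith, ?_⟩
      have h4 := hlin t ht
      have h5 : 0 ≤ n * D t 0 := mul_nonneg hn0 (hD0 t 0)
      have h6 : -|U| ≤ U := neg_abs_le U
      simp only [hΦ] at hlt'
      nlinarith
  obtain ⟨β, t, z, h1, h2, h3, h4, h5, h6⟩ := hu.exists_touching (φ := φ) (φt := φt) (φx := φx)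
    (a := t₀) (b := T') (R := C + |U| + (|l| + η) * T + x + |q| * T + s)
    (fun β => by
      simp only [hφ]
      split_ifs
      · exact hΦc
      · have e1 : ContDiff ℝ 1 fun p : ℝ × ℝ => Φ p.1 0 :=
          hΦc.comp (by fun_prop : ContDiff ℝ 1 fun p : ℝ × ℝ => (p.1, (0 : ℝ)))
        fun_prop)
    (fun β t z => by
      simp only [hφ, hφt]
      split_ifs
      · exact hΦdt t z
      · exact (hΦdt t 0).add_const _)
    (fun β t z => by
      simp only [hφ, hφx]
      split_ifs
      · exact hΦdx t z
      · simpa using ((hasDerivAt_id z).const_mul B).const_add (Φ t 0))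
    (fun β γ t => by rw [hφ0, hφ0]) ht₀.le (by linarith)
    (fun β t z ht hz hlt => by
      obtain ⟨h1, h2, h3⟩ := hpos β t z ht hz hlt
      exact ⟨⟨h1.le, h2⟩, h3⟩)
    (fun β z hz _ => by
      by_contra! hlt
      exact lt_irrefl _ (hpos β t₀ z ⟨ht₀, by linarith⟩ hz hlt).1)
    ⟨α, t₁, x + q * h, ⟨by linarith, by linarith⟩, hxq, by
      have e : X t₁ = x + q * h := by simp only [hX, ht₁]; ring
      have e' : D t₁ (x + q * h) = 0 := by
        simp only [hD, e, sub_self, max_self]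
        rw [max_eq_right (by linarith)]
        norm_num
      simp only [hφ, if_true, hΦ, e']
      rw [ht₁]
      linarith⟩
  have htT : t ∈ Ioo 0 T := ⟨by linarith, by linarith⟩
  have hcone : ∀ z, l + η ≤ Φt t z + q * Φx t z := by
    intro z
    have e1 : max (t₀ - t) 0 = 0 := max_eq_right (by linarith)
    have e2 : 0 ≤ n * max (t - t₁) 0 := mul_nonneg hn0 (le_max_right _ _)
    simp only [hΦt, hΦx, e1]
    linarith
  rcases h3.eq_or_lt with hz | hz
  · have h7 := h6 hz.symm
    have e : φt β t 0 = Φt t 0 := by simp only [hφt]; split_ifs <;> rfl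
    rw [e] at h7
    have h8 : Hm (H α) (p₀ α) (Φx t 0) ≤
        sSup (Set.range fun γ => Hm (H γ) (p₀ γ) (φx γ t 0)) :=
      le_csSup (finite_range _).bddAbove ⟨α, by simp [hφx]⟩
    rcases le_or_gt q 0 with hq | hq
    · have := hd.le_Hm α (Φx t 0) q hq
      linarith [hcone 0]
    · rw [← hz, hφ0] at h4
      have h9 := (hDlt t 0 (hDs t htT 0 le_rfl
        (h4.trans_le (hub β t 0 ⟨htT.1.le, htT.2⟩ le_rfl)))).1
      have h10 : 0 ≤ q * (t - t₀) := mul_nonneg hq.le (by linarith)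
      rw [abs_lt] at h9
      simp only [hX] at h9
      linarith
  · have h7 := h5 hz
    simp only [hφt, hφx] at h7
    split_ifs at h7 with hβ
    · subst hβ
      have := hd.le_H β (Φx t z) q
      linarith [hcone z]
    · have h8 := hE t ⟨h1.le, h2⟩
      rw [Real.norm_eq_abs, abs_le] at h8
      linarith [hBE β]

theorem IsViscSubSol.le_add_mul (hu : IsViscSubSol T H p₀ u) (hd : IsDual H p₀ L)
    (hH : ∀ α, Tendsto (H α) atTop atTop) (hC : 0 < C)
    (hub : ∀ (α : Fin N) (t x : ℝ), t ∈ Ico 0 T → 0 ≤ x → u α t x ≤ C * (1 + x))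
    {α : Fin N} {t₀ h x q : ℝ} (ht₀ : 0 ≤ t₀) (hh : 0 < h) (hx : 0 ≤ x) (hxq : 0 ≤ x + q * h)
    (hT : t₀ + h < T) : u α (t₀ + h) (x + q * h) ≤ u α t₀ x + h * L α q := by
  refine le_of_forall_pos_le_add fun ε hε => ?_
  have husc : ∀ᶠ r in nhdsWithin (0 : ℝ) (Ioi 0), u α (t₀ + r) (x + r) < u α t₀ x + ε / 2 := by
    have h1 := hu.1 α (t₀, x) ⟨⟨ht₀, by linarith⟩, hx⟩ (u α t₀ x + ε / 2) (by simp only; linarith)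
    have h2 : Tendsto (fun r : ℝ => (t₀ + r, x + r)) (nhdsWithin 0 (Ioi 0))
        (nhdsWithin (t₀, x) (Ico 0 T ×ˢ Ici 0)) := by
      refine tendsto_nhdsWithin_iff.2 ⟨?_, ?_⟩
      · have : Continuous fun r : ℝ => (t₀ + r, x + r) := by fun_prop
        simpa using (this.tendsto 0).mono_left nhdsWithin_le_nhds
      · filter_upwards [self_mem_nhdsWithin,
          nhdsWithin_le_nhds (Iio_mem_nhds (by linarith : (0 : ℝ) < T - t₀))] with r h3 h4
        rw [mem_Ioi] at h3
        rw [mem_Iio] at h4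
        exact ⟨⟨by simp only; linarith, by simp only; linarith⟩, by simp only [mem_Ici]; linarith⟩
    exact h2.eventually h1
  have hcost : ∀ᶠ r in nhdsWithin (0 : ℝ) (Ioi 0),
      (h - r) * L α ((x + q * h - (x + r)) / (h - r)) < h * L α q + ε / 2 := by
    have hc : ContinuousAt (fun r => (h - r) * L α ((x + q * h - (x + r)) / (h - r))) 0 := by
      have h1 : ContinuousAt (fun r => (x + q * h - (x + r)) / (h - r)) 0 :=
        ContinuousAt.div (by fun_prop) (by fun_prop) (by simpa using hh.ne')
      exact ContinuousAt.mul (by fun_prop) ((hd.continuous α).continuousAt.comp h1)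
    have hlt : (h - 0) * L α ((x + q * h - (x + 0)) / (h - 0)) < h * L α q + ε / 2 := by
      rw [sub_zero, add_zero, add_sub_cancel_left, mul_div_cancel_right₀ _ hh.ne']
      linarith
    exact nhdsWithin_le_nhds (hc.eventually (gt_mem_nhds hlt))
  obtain ⟨r, h1, h2, h3, h4⟩ := (husc.and (hcost.and ((eventually_mem_nhdsWithin).and
    (nhdsWithin_le_nhds (Iio_mem_nhds hh))))).exists
  have h5 : 0 < r := h3
  have e : x + r + (x + q * h - (x + r)) / (h - r) * (h - r) = x + q * h := by
    rw [div_mul_cancel₀ _ (by linarith)]; ring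
  have := hu.le_add_mul_of_pos hd hH hC hub (α := α) (t₀ := t₀ + r) (h := h - r) (x := x + r)
    (q := (x + q * h - (x + r)) / (h - r)) (by linarith) (by linarith) (by linarith)
    (by rwa [e]) (by linarith)
  rw [e, show t₀ + r + (h - r) = t₀ + h by ring] at this
  linarith

end LineInequality

/-- The function `u`, extended to non-positive times by `u₀ x - K * t` and truncated from above
by the affine function `A - B * x - K * t`. -/
noncomputable def extendTrunc (K A B : ℝ) (u₀ : ℝ → ℝ) (u : ℝ → ℝ → ℝ) (t x : ℝ) : ℝ :=
  min (if 0 < t then u t x else u₀ x - K * t) (A - B * x - K * t)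

section ExtendTrunc

variable {K A B Λ S T : ℝ} {L u₀ : ℝ → ℝ} {u : ℝ → ℝ → ℝ}

theorem lineIneq_extendTrunc (hu : ∀ t x q h, 0 ≤ t → 0 < h → 0 ≤ x → 0 ≤ x + q * h → t + h < T →
      u (t + h) (x + q * h) ≤ u t x + h * L q) (hu₀ : ∀ x, 0 ≤ x → u 0 x ≤ u₀ x)
    (hΛ : ∀ x y, 0 ≤ x → 0 ≤ y → u₀ x ≤ u₀ y + Λ * |x - y|) (hKΛ : ∀ q, Λ * |q| - L q ≤ K)
    (hKB : ∀ q, -B * q - L q ≤ K) (hS : S < T) : LineIneq L S (extendTrunc K A B u₀ u) := by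
  intro t x q h hh hx hxq ht
  have hinit : ∀ τ, 0 ≤ τ → 0 ≤ x + q * τ → u₀ (x + q * τ) ≤ u₀ x + τ * L q + K * τ := by
    intro τ hτ hxτ
    have h1 := hΛ (x + q * τ) x hxτ hx
    rw [add_sub_cancel_left, abs_mul, abs_of_nonneg hτ] at h1
    have h2 := mul_le_mul_of_nonneg_left (hKΛ q) hτ
    linarith
  rw [extendTrunc, extendTrunc, ← min_add_add_right]
  refine min_le_min ?_ ?_
  · rcases lt_or_ge 0 t with h0 | h0
    · rw [if_pos h0, if_pos (by linarith)]
      exact hu t x q h h0.le hh hx hxq (by linarith)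
    · rw [if_neg h0.not_gt]
      split_ifs with h1
      · have hm : 0 ≤ x + q * -t := by
          have : x + q * -t = ((t + h) * x + -t * (x + q * h)) / h := by field_simp; ring
          rw [this]
          have h2 : 0 ≤ -t := by linarith
          positivity
        have h2 := hu 0 (x + q * -t) q (t + h) le_rfl h1 hm (by ring_nf; linarith) (by linarith)
        rw [zero_add, show x + q * -t + q * (t + h) = x + q * h by ring] at h2
        linarith [hu₀ _ hm, hinit (-t) (by linarith) hm]
      · linarith [hinit h hh.le hxq]
  · have h1 := mul_le_mul_of_nonneg_left (hKB q) hh.le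
    linarith

theorem extendTrunc_le {t x : ℝ} : extendTrunc K A B u₀ u t x ≤ A - B * x - K * t :=
  min_le_right _ _

theorem extendTrunc_le_of_nonpos {t x : ℝ} (ht : t ≤ 0) :
    extendTrunc K A B u₀ u t x ≤ u₀ x - K * t := by
  rw [extendTrunc, if_neg ht.not_gt]
  exact min_le_left _ _

theorem extendTrunc_eq {t x : ℝ} (ht : 0 < t) (h : u t x ≤ A - B * x - K * t) :
    extendTrunc K A B u₀ u t x = u t x := by
  rw [extendTrunc, if_pos ht, min_eq_left h]

end ExtendTrunc

section AverageBounds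

variable {L : ℝ → ℝ} {S S₁ δ t x M : ℝ} {w : ℝ → ℝ → ℝ}

theorem LineIneq.timeAvg_clampedAvg_le (hw : LineIneq L S w) (hL : Continuous L) (hδ : 0 < δ)
    (hS : S₁ < S) (hx : 0 ≤ x)
    (hM : ∀ τ, min t S₁ - 2 * δ ≤ τ → τ ≤ min t S₁ → w τ x ≤ M) :
    _root_.timeAvg δ (_root_.clampedAvg δ S₁ w) t x ≤ M := by
  have hle : ∀ {f : ℝ → ℝ}, IntervalIntegrable f MeasureTheory.volume 0 1 →
      (∀ s ∈ Icc (0 : ℝ) 1, f s ≤ M) → ∫ s in (0 : ℝ)..1, f s ≤ M := fun hf h => by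
    simpa using intervalIntegral.integral_mono_on zero_le_one hf intervalIntegrable_const h
  have hc := (hw.continuous_clampedAvg hL hδ hS).comp
    (by fun_prop : Continuous fun s : ℝ => (t - δ * s, x))
  refine hle (hc.intervalIntegrable 0 1) fun s hs => ?_
  have h1 : min (t - δ * s) S₁ ≤ min t S₁ :=
    min_le_min_right _ (by linarith [mul_nonneg hδ.le hs.1])
  have h2 : min t S₁ - δ ≤ min (t - δ * s) S₁ := by
    have := mul_le_mul_of_nonneg_left hs.2 hδ.le
    exact le_min (by linarith [min_le_left t S₁]) (by linarith [min_le_right t S₁])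
  simp only [_root_.clampedAvg]
  rw [max_eq_left hx]
  refine hle (hw.intervalIntegrable hδ ((min_le_right _ _).trans hS.le) hx) fun r hr => hM _ ?_ ?_
  · linarith [mul_le_mul_of_nonneg_left hr.2 hδ.le]
  · linarith [mul_nonneg hδ.le hr.1]

theorem LineIneq.le_timeAvg_clampedAvg (hw : LineIneq L S w) (hL : Continuous L) (hδ : 0 < δ)
    (hS : S₁ < S) (hx : 0 ≤ x)
    (hM : ∀ τ, min t S₁ - 2 * δ ≤ τ → τ ≤ min t S₁ → M ≤ w τ x) :
    M ≤ _root_.timeAvg δ (_root_.clampedAvg δ S₁ w) t x := by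
  have hle : ∀ {f : ℝ → ℝ}, IntervalIntegrable f MeasureTheory.volume 0 1 →
      (∀ s ∈ Icc (0 : ℝ) 1, M ≤ f s) → M ≤ ∫ s in (0 : ℝ)..1, f s := fun hf h => by
    simpa using intervalIntegral.integral_mono_on zero_le_one intervalIntegrable_const hf h
  have hc := (hw.continuous_clampedAvg hL hδ hS).comp
    (by fun_prop : Continuous fun s : ℝ => (t - δ * s, x))
  refine hle (hc.intervalIntegrable 0 1) fun s hs => ?_
  have h1 : min (t - δ * s) S₁ ≤ min t S₁ :=
    min_le_min_right _ (by linarith [mul_nonneg hδ.le hs.1])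
  have h2 : min t S₁ - δ ≤ min (t - δ * s) S₁ := by
    have := mul_le_mul_of_nonneg_left hs.2 hδ.le
    exact le_min (by linarith [min_le_left t S₁]) (by linarith [min_le_right t S₁])
  simp only [_root_.clampedAvg]
  rw [max_eq_left hx]
  refine hle (hw.intervalIntegrable hδ ((min_le_right _ _).trans hS.le) hx) fun r hr => hM _ ?_ ?_
  · linarith [mul_le_mul_of_nonneg_left hr.2 hδ.le]
  · linarith [mul_nonneg hδ.le hr.1]

end AverageBounds

/-- **Comparison principle on a junction** (Proposition 3.4, from [IMZ]).
Assume (A0)-(A1′) and let `T > 0`. If `ubar` is a viscosity subsolution and `ulow` a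
viscosity supersolution of (HJ)-(CI) on `[0,T) × J` satisfying the sublinear growth
bounds `ubar(t,y) ≤ C_T(1+|y|)` and `ulow(t,y) ≥ -C_T(1+|y|)`, then `ubar ≤ ulow` on
`(0,T) × J`. -/
theorem comparison_principle_junction {N : ℕ} (hN : 1 ≤ N)
    (H : Fin N → ℝ → ℝ) (p₀ : Fin N → ℝ)
    (hA1 : ∀ α, A1cond (H α) (p₀ α))
    (hA1' : A1primeCond H p₀)
    (u₀ : Fin N → ℝ → ℝ) (hA0 : A0cond u₀)
    (T : ℝ) (hT : 0 < T)
    (ubar ulow : Fin N → ℝ → ℝ → ℝ)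
    (hsub : IsViscSubSolCI T H p₀ u₀ ubar)
    (hsuper : IsViscSuperSolCI T H p₀ u₀ ulow)
    (C : ℝ) (hC : 0 < C)
    (hub : ∀ (α : Fin N) (t x : ℝ), t ∈ Ico 0 T → 0 ≤ x → ubar α t x ≤ C * (1 + x))
    (hlb : ∀ (α : Fin N) (t x : ℝ), t ∈ Ico 0 T → 0 ≤ x → -(C * (1 + x)) ≤ ulow α t x) :
    ∀ (α : Fin N) (t x : ℝ), t ∈ Ioo 0 T → 0 ≤ x → ubar α t x ≤ ulow α t x := by
  intro α₀ t₀ x₀ ht₀ hx₀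
  by_contra! hcon
  obtain ⟨L, hd⟩ := hA1'.exists_isDual
  obtain ⟨hsub, hsub0⟩ := hsub
  obtain ⟨hsuper, hsuper0⟩ := hsuper
  obtain ⟨g, hg⟩ : ∃ g, g = ubar α₀ t₀ x₀ - ulow α₀ t₀ x₀ := ⟨_, rfl⟩
  have hg0 : 0 < g := by linarith
  obtain ⟨T₁, hT₁, hT₁T⟩ := exists_between ht₀.2
  obtain ⟨T₂, hT₁₂, hT₂⟩ := exists_between hT₁T
  have hT₁0 : 0 < T₁ := ht₀.1.trans hT₁
  choose Λ' hΛ' using hA0.1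
  obtain ⟨Λ, hΛ0, hΛ⟩ : ∃ Λ : ℝ, 0 ≤ Λ ∧ ∀ α, (Λ' α : ℝ) ≤ Λ :=
    ((eventually_ge_atTop 0).and (eventually_all.2 fun α => eventually_ge_atTop _)).exists
  have hu₀ : ∀ α x y, 0 ≤ x → 0 ≤ y → u₀ α x ≤ u₀ α y + Λ * |x - y| := fun α x y hx hy => by
    have h1 := (hΛ' α).dist_le_mul x hx y hy
    rw [Real.dist_eq, Real.dist_eq] at h1
    have h2 := mul_le_mul_of_nonneg_right (hΛ α) (abs_nonneg (x - y))
    linarith [le_abs_self (u₀ α x - u₀ α y)]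
  obtain ⟨B, hB⟩ : ∃ B, B = C + 1 := ⟨_, rfl⟩
  obtain ⟨K, hK0, hK⟩ : ∃ K, 0 ≤ K ∧ ∀ α, H α (-B) ≤ K ∧ H α Λ ≤ K ∧ H α (-Λ) ≤ K :=
    ((eventually_ge_atTop 0).and (eventually_all.2 fun α => (eventually_ge_atTop _).and
      ((eventually_ge_atTop _).and (eventually_ge_atTop _)))).exists
  have hKB : ∀ α q, -B * q - L α q ≤ K := fun α q => (hd.le_H α _ q).trans (hK α).1
  have hKΛ : ∀ α q, Λ * |q| - L α q ≤ K := fun α q => by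
    rcases abs_cases q with h | h
    · rw [h.1]; exact (hd.le_H α _ q).trans (hK α).2.1
    · rw [h.1, mul_neg, ← neg_mul]; exact (hd.le_H α _ q).trans (hK α).2.2
  obtain ⟨A, hA⟩ : ∃ A, A = ubar α₀ t₀ x₀ + B * x₀ + K * t₀ := ⟨_, rfl⟩
  set w : Fin N → ℝ → ℝ → ℝ := fun α => extendTrunc K A B (u₀ α) (ubar α) with hw
  have hline : ∀ α, LineIneq (L α) T₂ (w α) := fun α =>
    lineIneq_extendTrunc (fun t x q h h0 hh hx hxq hT => hsub.le_add_mul hd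
      (fun α => (hA1 α).2.1.mono_left atTop_le_cocompact) hC hub h0 hh hx hxq hT) (hsub0 α)
      (hu₀ α) (hKΛ α) (hKB α) hT₂
  have hw0 : ∀ α β t, w α t 0 = w β t 0 := fun α β t => by
    simp only [hw, extendTrunc, hsub.2.1 α β, hA0.2 α β]
  have hwt₀ : w α₀ t₀ x₀ = ubar α₀ t₀ x₀ := extendTrunc_eq ht₀.1 (by linarith)
  -- small parameters
  obtain ⟨η, hη0, hη⟩ : ∃ η > 0, η * t₀ ≤ g / 8 :=
    ⟨g / (8 * t₀), div_pos hg0 (by linarith [ht₀.1]), by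
      rw [div_mul_eq_mul_div, mul_comm 8 t₀, mul_comm g, mul_div_mul_left _ _ ht₀.1.ne']⟩
  obtain ⟨ρ, hρ0, hρη, hρg, hρ1⟩ : ∃ ρ > 0, ρ < η ∧ ρ ≤ g / 8 ∧ ρ ≤ 1 :=
    ⟨min (η / 2) (min (g / 8) 1), by positivity, (min_le_left _ _).trans_lt (by linarith),
      (min_le_right _ _).trans (min_le_left _ _), (min_le_right _ _).trans (min_le_right _ _)⟩
  have hKL : 0 < K + |L α₀ 0| + 1 := by positivity
  obtain ⟨δ, hδ0, hδ1, hδg⟩ : ∃ δ > 0, δ ≤ 1 ∧ (K + |L α₀ 0| + 1) * δ ≤ g / 8 := by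
    refine ⟨min 1 (g / 8 / (K + |L α₀ 0| + 1)), by positivity, min_le_left _ _, ?_⟩
    rw [← le_div_iff₀' hKL]
    exact min_le_right _ _
  have hKδ : 0 ≤ K * δ := by positivity
  have hKδ1 : K * δ ≤ K := mul_le_of_le_one_right hK0 hδ1
  obtain ⟨Q, hQ⟩ : ∃ Q, Q = max (A + 2 * K + 1 + C) x₀ := ⟨_, rfl⟩
  have hQA : A + 2 * K + 1 + C ≤ Q := hQ ▸ le_max_left _ _
  have hQx : x₀ ≤ Q := hQ ▸ le_max_right _ _
  have hQ0 : 0 ≤ Q := hx₀.trans hQx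
  obtain ⟨W, Wt, Wx, hWc, hWdt, hWdx, hW0, hWH, hWF, hWA⟩ := exists_smooth_approx (T := T)
    hline hd.continuous hw0 hT₁₂ hδ0 hρ0 hQ0
  have hKτ : ∀ τ, -(2 * δ) ≤ τ → -(K * τ) ≤ 2 * (K * δ) := fun τ hτ => by
    have := mul_le_mul_of_nonneg_left hτ hK0
    linarith
  have hWaff : ∀ α, ∀ t ∈ Icc 0 T, ∀ x, 0 ≤ x → W α t x ≤ A + 2 * (K * δ) - B * x + ρ := by
    refine fun α t ht => hWA α t ht _ B (by linarith) fun y hy => ?_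
    refine (hline α).timeAvg_clampedAvg_le (hd.continuous α) hδ0 hT₁₂ hy fun τ h1 _ => ?_
    have h2 : 0 ≤ min t T₁ := le_min ht.1 hT₁0.le
    have h3 : w α τ y ≤ A - B * y - K * τ := extendTrunc_le
    linarith [hKτ τ (by linarith)]
  have hWinit : ∀ α, ∀ x ∈ Icc 0 Q, W α 0 x ≤ u₀ α x + 2 * (K * δ) + ρ := by
    intro α x hx
    have h1 := (abs_le.1 (hWF α 0 ⟨le_rfl, hT.le⟩ x hx)).2
    have h2 := (hline α).timeAvg_clampedAvg_le (t := 0) (M := u₀ α x + 2 * (K * δ))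
      (hd.continuous α) hδ0 hT₁₂ hx.1 fun τ h1 h2 => by
        rw [min_eq_left hT₁0.le] at h1 h2
        have h3 : w α τ x ≤ u₀ α x - K * τ := extendTrunc_le_of_nonpos h2
        linarith [hKτ τ (by linarith)]
    linarith
  have hWt₀ : ubar α₀ t₀ x₀ - 2 * (|L α₀ 0| * δ) - ρ ≤ W α₀ t₀ x₀ := by
    have h1 := (abs_le.1 (hWF α₀ t₀ ⟨ht₀.1.le, ht₀.2.le⟩ x₀ ⟨hx₀, hQx⟩)).1
    have h2 := (hline α₀).le_timeAvg_clampedAvg (t := t₀)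
      (M := ubar α₀ t₀ x₀ - 2 * (|L α₀ 0| * δ))
      (hd.continuous α₀) hδ0 hT₁₂ hx₀ fun τ h1 h2 => by
        rw [min_eq_left hT₁.le] at h1 h2
        have h5 : 0 ≤ |L α₀ 0| * δ := by positivity
        rw [← hwt₀]
        rcases h2.eq_or_lt with rfl | h3
        · linarith
        · have h4 := (hline α₀).le_of_lt h3 (by linarith) hx₀
          have h6 : (t₀ - τ) * L α₀ 0 ≤ 2 * δ * |L α₀ 0| :=
            (mul_le_mul_of_nonneg_left (le_abs_self _) (by linarith)).trans
              (mul_le_mul_of_nonneg_right (by linarith) (abs_nonneg _))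
          linarith
    linarith
  -- the test function
  obtain ⟨n, hn⟩ : ∃ n, n = Q / (T₁ - t₀) ^ 2 := ⟨_, rfl⟩
  have hTt : 0 < T₁ - t₀ := by linarith
  have hn0 : 0 ≤ n := by rw [hn]; positivity
  set φ : Fin N → ℝ → ℝ → ℝ := fun α t x =>
    W α t x + (-(η * t) - n * max (t - t₀) 0 ^ 2 - (2 * (K * δ) + ρ)) with hφ
  set φt : Fin N → ℝ → ℝ → ℝ := fun α t x =>
    Wt α t x + (-η - n * (2 * max (t - t₀) 0)) with hφt
  have hpen : ∀ t, 0 ≤ n * max (t - t₀) 0 ^ 2 := fun t => by positivity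
  have hpos : ∀ β t z, t ∈ Ioo 0 T → 0 ≤ z → ulow β t z < φ β t z → t < T₁ ∧ z ≤ Q := by
    intro β t z ht hz hlt
    have h1 := hlb β t z ⟨ht.1.le, ht.2⟩ hz
    have h2 := hWaff β t ⟨ht.1.le, ht.2.le⟩ z hz
    have h3 := hpen t
    have h4 : 0 ≤ η * t := mul_nonneg hη0.le ht.1.le
    simp only [hφ] at hlt
    rw [hB] at h2
    have h5 : n * max (t - t₀) 0 ^ 2 < Q - z := by linarith
    refine ⟨?_, by linarith⟩
    by_contra! hle
    have h6 : Q ≤ n * max (t - t₀) 0 ^ 2 := by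
      rw [hn, div_mul_eq_mul_div, le_div_iff₀ (by positivity)]
      have : T₁ - t₀ ≤ max (t - t₀) 0 := le_max_of_le_left (by linarith)
      gcongr
    linarith
  obtain ⟨β, t, z, h1, h2, h3, h4, h5, h6⟩ := hsuper.exists_touching (φ := φ) (φt := φt)
    (φx := Wx) (a := 0) (b := T₁) (R := Q)
    (fun α => by
      have : ContDiff ℝ 1 fun p : ℝ × ℝ => max (p.1 - t₀) 0 ^ 2 :=
        contDiff_max_zero_sq.comp (by fun_prop : ContDiff ℝ 1 fun p : ℝ × ℝ => p.1 - t₀)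
      have := hWc α
      simp only [hφ]
      fun_prop)
    (fun α t x => by
      have e1 : HasDerivAt (fun t => t - t₀) 1 t := (hasDerivAt_id t).sub_const t₀
      have e2 : HasDerivAt (fun t => max (t - t₀) 0 ^ 2) (2 * max (t - t₀) 0 * 1) t :=
        HasDerivAt.comp (h₂ := fun s => max s 0 ^ 2) t (hasDerivAt_max_zero_sq (t - t₀)) e1
      rw [mul_one] at e2
      have e3 : HasDerivAt (fun t => -(η * t)) (-(η * 1)) t :=
        ((hasDerivAt_id t).const_mul η).neg
      rw [mul_one] at e3
      exact (hWdt α t x).add ((e3.sub (e2.const_mul n)).sub_const _))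
    (fun α t x => (hWdx α t x).add_const _) (fun α β t => by simp only [hφ, hW0 α β]) le_rfl hT₁T
    (fun β t z ht hz hlt => by
      obtain ⟨h1, h2⟩ := hpos β t z ht hz hlt
      exact ⟨⟨ht.1.le, h1.le⟩, h2⟩)
    (fun β z hz hz' => by
      have h1 := hWinit β z ⟨hz, hz'⟩
      have h2 := hsuper0 β z hz
      have h3 := hpen 0
      simp only [hφ]
      linarith)
    ⟨α₀, t₀, x₀, ht₀, hx₀, by
      simp only [hφ, sub_self, max_self]
      norm_num
      linarith⟩
  have htT : t ∈ Ioo 0 T := ⟨h1, by linarith⟩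
  have htT₁ := (hpos β t z htT h3 h4).1
  have hmax : 0 ≤ n * (2 * max (t - t₀) 0) :=
    mul_nonneg hn0 (mul_nonneg zero_le_two (le_max_right _ _))
  have hWHq : ∀ γ x, 0 ≤ x → ∀ q, Wx γ t x * q - L γ q ≤ ρ - Wt γ t x := fun γ x hx q => by
    linarith [hWH γ t x q h1.le htT₁ htT.2.le hx]
  rcases h3.eq_or_lt with hz | hz
  · have h7 := h6 hz.symm
    have h8 : sSup (Set.range fun γ => Hm (H γ) (p₀ γ) (Wx γ t 0)) ≤ ρ - Wt β t 0 := by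
      refine csSup_le ⟨_, β, rfl⟩ ?_
      rintro _ ⟨γ, rfl⟩
      have e : Wt γ t 0 = Wt β t 0 := by
        refine (hWdt γ t 0).unique ?_
        simpa only [hW0 γ β] using hWdt β t 0
      exact hd.Hm_le γ _ _ (e ▸ hWHq γ 0 le_rfl)
    simp only [hφt] at h7
    linarith
  · have h7 := h5 hz
    have h8 := hd.H_le β _ _ (hWHq β z h3)
    simp only [hφt] at h7
    linarith
end

section
/- (Derived Godunov-type scheme for the densities) In the traffic setting, let (U^{α,n}_i) solve the scheme (NS) with the traffic Hamiltonians, and define the discrete densities ρ^{α,n}_i by ρ^{α,n}_i = γ^α (U^{α,n}_{|i|} − U^{α,n}_{|i|−1})/Δx for i ≤ −1 and incoming α ≤ N_I, and ρ^{α,n}_i = −γ^α (U^{α,n}_{i+1} − U^{α,n}_i)/Δx for i ≥ 0 and outgoing α ≥ N_I+1. Then for all n ≥ 0: (Δx/Δt)(ρ^{α,n+1}_i − ρ^{α,n}_i) = F^α(ρ^{α,n}_{i−1}, ρ^{α,n}_i) − F^α(ρ^{α,n}_i, ρ^{α,n}_{i+1}) whenever i ≤ −2 and α ≤ N_I or i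 ≥ 1 and α ≥ N_I+1; (Δx/Δt)(ρ^{α,n+1}_0 − ρ^{α,n}_0) = γ^α F₀ − F^α(ρ^{α,n}_0, ρ^{α,n}_1) for outgoing α ≥ N_I+1; and (Δx/Δt)(ρ^{α,n+1}_{−1} − ρ^{α,n}_{−1}) = F^α(ρ^{α,n}_{−2}, ρ^{α,n}_{−1}) − γ^α F₀ for incoming α ≤ N_I; where F^α(a,b) = min{f^α_D(a), f^α_S(b)} and F₀ = min{ min_{β≤N_I} (1/γ^β) f^β_D(ρ^{β,n}_{−1}), min_{λ≥N_I+1} (1/γ^λ) f^λ_S(ρ^{λ,n}_0) }. -/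
open Set Filter

/-- The demand function `f_D` associated with a flux `f` with critical density `ρc`. -/
noncomputable def demandF (f : ℝ → ℝ) (ρc : ℝ) (p : ℝ) : ℝ :=
  if p ≤ ρc then f p else f ρc

/-- The supply function `f_S` associated with a flux `f` with critical density `ρc`. -/
noncomputable def supplyF (f : ℝ → ℝ) (ρc : ℝ) (p : ℝ) : ℝ :=
  if p ≤ ρc then f ρc else f p

/-- Structural assumptions on a traffic flux function (fundamental diagram): `ρc > 0` is
the unique maximum point, `f` is non-decreasing before `ρc` and non-increasing after. -/
def TrafficFlux (f : ℝ → ℝ) (ρc : ℝ) : Prop :=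
  0 < ρc ∧ MonotoneOn f (Iic ρc) ∧ AntitoneOn f (Ici ρc) ∧
    ∀ p : ℝ, p ≠ ρc → f p < f ρc

/-- The traffic Hamiltonian on branch `α`: `H_α(p) = -(1/γ^α) f^α(γ^α p)` on incoming
branches (`α.val < NI`) and `H_α(p) = -(1/γ^α) f^α(-γ^α p)` on outgoing branches. -/
noncomputable def trafficH (NI : ℕ) {N : ℕ} (γ : Fin N → ℝ) (f : Fin N → ℝ → ℝ)
    (α : Fin N) (p : ℝ) : ℝ :=
  if α.val < NI then -(1 / γ α) * f α (γ α * p) else -(1 / γ α) * f α (-(γ α * p))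

/-- The turning point of the traffic Hamiltonian on branch `α`. -/
noncomputable def trafficP0 (NI : ℕ) {N : ℕ} (γ : Fin N → ℝ) (ρc : Fin N → ℝ)
    (α : Fin N) : ℝ :=
  if α.val < NI then ρc α / γ α else -(ρc α / γ α)

/-- The Godunov flux `F^α(a,b) = min(f^α_D(a), f^α_S(b))`. -/
noncomputable def godunovF (f : ℝ → ℝ) (ρc : ℝ) (a b : ℝ) : ℝ :=
  min (demandF f ρc a) (supplyF f ρc b)

/-- The junction flux
`F₀ = min( min_{β ≤ N_I} f^β_D(ρin β)/γ^β , min_{λ ≥ N_I+1} f^λ_S(ρout λ)/γ^λ )`. -/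
noncomputable def junctionF0 (NI : ℕ) {N : ℕ} (γ : Fin N → ℝ) (f : Fin N → ℝ → ℝ)
    (ρc : Fin N → ℝ) (ρin ρout : Fin N → ℝ) : ℝ :=
  min (sInf {v : ℝ | ∃ β : Fin N, β.val < NI ∧
        v = (1 / γ β) * demandF (f β) (ρc β) (ρin β)})
      (sInf {v : ℝ | ∃ lam : Fin N, NI ≤ lam.val ∧
        v = (1 / γ lam) * supplyF (f lam) (ρc lam) (ρout lam)})

lemma Hm_trafficH_incoming {NI N : ℕ} {γ : Fin N → ℝ} (f : Fin N → ℝ → ℝ) (ρc : Fin N → ℝ)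
    {α : Fin N} (hγ : 0 < γ α) (hα : α.val < NI) (p : ℝ) :
    Hm (trafficH NI γ f α) (trafficP0 NI γ ρc α) p
      = -((1 / γ α) * demandF (f α) (ρc α) (γ α * p)) := by
  have hturn : p ≤ ρc α / γ α ↔ γ α * p ≤ ρc α := by rw [le_div_iff₀ hγ, mul_comm]
  have hcrit : γ α * (ρc α / γ α) = ρc α := by field_simp
  simp only [Hm, trafficH, trafficP0, demandF, if_pos hα, hturn, hcrit]
  split_ifs <;> ring

lemma Hp_trafficH_incoming {NI N : ℕ} {γ : Fin N → ℝ} (f : Fin N → ℝ → ℝ) (ρc : Fin N → ℝ)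
    {α : Fin N} (hγ : 0 < γ α) (hα : α.val < NI) (p : ℝ) :
    Hp (trafficH NI γ f α) (trafficP0 NI γ ρc α) p
      = -((1 / γ α) * supplyF (f α) (ρc α) (γ α * p)) := by
  have hturn : p ≤ ρc α / γ α ↔ γ α * p ≤ ρc α := by rw [le_div_iff₀ hγ, mul_comm]
  have hcrit : γ α * (ρc α / γ α) = ρc α := by field_simp
  simp only [Hp, trafficH, trafficP0, supplyF, if_pos hα, hturn, hcrit]
  split_ifs <;> ring

lemma Hm_trafficH_outgoing {NI N : ℕ} {γ : Fin N → ℝ} (f : Fin N → ℝ → ℝ) (ρc : Fin N → ℝ)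
    {α : Fin N} (hγ : 0 < γ α) (hα : NI ≤ α.val) (p : ℝ) :
    Hm (trafficH NI γ f α) (trafficP0 NI γ ρc α) p
      = -((1 / γ α) * supplyF (f α) (ρc α) (-(γ α) * p)) := by
  have hturn : p ≤ -(ρc α / γ α) ↔ ρc α ≤ -(γ α * p) := by
    rw [le_neg, div_le_iff₀ hγ, neg_mul, mul_comm]
  have hcrit : -(γ α * -(ρc α / γ α)) = ρc α := by field_simp
  simp only [Hm, trafficH, trafficP0, supplyF, if_neg hα.not_gt, hturn, hcrit, neg_mul]
  rcases lt_trichotomy (ρc α) (-(γ α * p)) with h | h | h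
  · rw [if_pos h.le, if_neg h.not_ge]
  · simp [← h]
  · rw [if_neg h.not_ge, if_pos h.le]

lemma Hp_trafficH_outgoing {NI N : ℕ} {γ : Fin N → ℝ} (f : Fin N → ℝ → ℝ) (ρc : Fin N → ℝ)
    {α : Fin N} (hγ : 0 < γ α) (hα : NI ≤ α.val) (p : ℝ) :
    Hp (trafficH NI γ f α) (trafficP0 NI γ ρc α) p
      = -((1 / γ α) * demandF (f α) (ρc α) (-(γ α) * p)) := by
  have hturn : p ≤ -(ρc α / γ α) ↔ ρc α ≤ -(γ α * p) := by
    rw [le_neg, div_le_iff₀ hγ, neg_mul, mul_comm]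
  have hcrit : -(γ α * -(ρc α / γ α)) = ρc α := by field_simp
  simp only [Hp, trafficH, trafficP0, demandF, if_neg hα.not_gt, hturn, hcrit, neg_mul]
  rcases lt_trichotomy (ρc α) (-(γ α * p)) with h | h | h
  · rw [if_pos h.le, if_neg h.not_ge]
  · simp [← h]
  · rw [if_neg h.not_ge, if_pos h.le]

lemma max_neg_mul_eq_neg_mul_min {c : ℝ} (hc : 0 ≤ c) (a b : ℝ) :
    max (-(c * a)) (-(c * b)) = -(c * min a b) := by
  rw [max_neg_neg, mul_min_of_nonneg _ _ hc]

/-- The supremum of a finite family split by a predicate, as the negative of the minimum of the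
two infima of the opposite values. -/
lemma sSup_range_eq_neg_min_sInf {ι : Type*} [Finite ι] (P Q : ι → Prop)
    (hPQ : ∀ i, P i ∨ Q i) (hP : ∃ i, P i) (hQ : ∃ i, Q i) (g a b : ι → ℝ)
    (ha : ∀ i, P i → g i = -a i) (hb : ∀ i, Q i → g i = -b i) :
    sSup (range g) = -min (sInf {v | ∃ i, P i ∧ v = a i}) (sInf {v | ∃ i, Q i ∧ v = b i}) := by
  have hfin (R : ι → Prop) (c : ι → ℝ) : BddBelow {v | ∃ i, R i ∧ v = c i} :=
    ((finite_range c).subset (by rintro _ ⟨i, -, rfl⟩; exact ⟨i, rfl⟩)).bddBelow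
  obtain ⟨i, hi⟩ := hP
  obtain ⟨j, hj⟩ := hQ
  rw [← csInf_union (hfin P a) ⟨a i, i, hi, rfl⟩ (hfin Q b) ⟨b j, j, hj, rfl⟩, ← Real.sSup_neg]
  congr 1
  ext v
  simp only [mem_range, Set.mem_neg, mem_union, mem_ofPred_eq]
  constructor
  · rintro ⟨k, rfl⟩
    rcases hPQ k with hk | hk
    · exact Or.inl ⟨k, hk, by rw [ha k hk, neg_neg]⟩
    · exact Or.inr ⟨k, hk, by rw [hb k hk, neg_neg]⟩
  · rintro (⟨k, hk, hv⟩ | ⟨k, hk, hv⟩)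
    · exact ⟨k, by rw [ha k hk, ← hv, neg_neg]⟩
    · exact ⟨k, by rw [hb k hk, ← hv, neg_neg]⟩

/-- **Derived Godunov-type scheme for the densities** (Lemma 4.1).
If `U` solves the scheme (NS) with the traffic Hamiltonians and the discrete densities
are defined by `ρ^{α,n}_i = γ^α p^{α,n}_{|i|-1,+}` (incoming, `i ≤ -1`) and
`ρ^{α,n}_i = -γ^α p^{α,n}_{i,+}` (outgoing, `i ≥ 0`), then the densities solve the
Godunov-type finite volume scheme with fluxes `F^α(a,b) = min(f^α_D(a), f^α_S(b))` away
from the junction and junction flux `γ^α F₀`. -/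
theorem derived_scheme_for_densities
    (NI NO : ℕ) (hNI : 1 ≤ NI) (hNO : 1 ≤ NO) {N : ℕ} (hN : N = NI + NO)
    (γ : Fin N → ℝ) (hγ : ∀ α, 0 < γ α ∧ γ α ≤ 1)
    (hγin : ∑ α ∈ Finset.univ.filter (fun α : Fin N => α.val < NI), γ α = 1)
    (hγout : ∑ α ∈ Finset.univ.filter (fun α : Fin N => NI ≤ α.val), γ α = 1)
    (f : Fin N → ℝ → ℝ) (ρc : Fin N → ℝ)
    (hf : ∀ α, TrafficFlux (f α) (ρc α))
    (Δx Δt : ℝ) (hΔx : 0 < Δx) (hΔt : 0 < Δt)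
    (U : Fin N → ℕ → ℕ → ℝ)
    (hU : SchemeNS (trafficH NI γ f) (trafficP0 NI γ ρc) Δx Δt U)
    (ρ : Fin N → ℕ → ℤ → ℝ)
    (hρin : ∀ α : Fin N, α.val < NI → ∀ (n : ℕ) (i : ℤ), i ≤ -1 →
      ρ α n i = γ α * ((U α n (-i).toNat - U α n ((-i).toNat - 1)) / Δx))
    (hρout : ∀ α : Fin N, NI ≤ α.val → ∀ (n : ℕ) (i : ℤ), 0 ≤ i →
      ρ α n i = -(γ α) * ((U α n (i.toNat + 1) - U α n i.toNat) / Δx)) :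
    ∀ n : ℕ,
      (∀ (α : Fin N) (i : ℤ),
        ((α.val < NI ∧ i ≤ -2) ∨ (NI ≤ α.val ∧ 1 ≤ i)) →
        Δx / Δt * (ρ α (n + 1) i - ρ α n i)
          = godunovF (f α) (ρc α) (ρ α n (i - 1)) (ρ α n i)
            - godunovF (f α) (ρc α) (ρ α n i) (ρ α n (i + 1))) ∧
      (∀ α : Fin N, NI ≤ α.val →
        Δx / Δt * (ρ α (n + 1) 0 - ρ α n 0)
          = γ α * junctionF0 NI γ f ρc (fun β => ρ β n (-1)) (fun lam => ρ lam n 0)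
            - godunovF (f α) (ρc α) (ρ α n 0) (ρ α n 1)) ∧
      (∀ α : Fin N, α.val < NI →
        Δx / Δt * (ρ α (n + 1) (-1) - ρ α n (-1))
          = godunovF (f α) (ρc α) (ρ α n (-2)) (ρ α n (-1))
            - γ α * junctionF0 NI γ f ρc (fun β => ρ β n (-1)) (fun lam => ρ lam n 0)) := by
  have hγpos (α : Fin N) : 0 < γ α := (hγ α).1
  have hinc (α : Fin N) (hα : α.val < NI) (n k : ℕ) :
      ρ α n (-(k : ℤ) - 1) = γ α * ((U α n (k + 1) - U α n k) / Δx) := by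
    have hk : (-(-(k : ℤ) - 1)).toNat = k + 1 := by omega
    rw [hρin α hα n _ (by omega), hk, Nat.add_sub_cancel]
  have hout (α : Fin N) (hα : NI ≤ α.val) (n k : ℕ) :
      ρ α n k = -(γ α) * ((U α n (k + 1) - U α n k) / Δx) := by
    rw [hρout α hα n _ (by omega), Int.toNat_natCast]
  have hstep_in (α : Fin N) (hα : α.val < NI) (n k : ℕ) :
      U α (n + 1) (k + 1) = U α n (k + 1) + Δt * (1 / γ α *
        godunovF (f α) (ρc α) (ρ α n (-(k : ℤ) - 2)) (ρ α n (-(k : ℤ) - 1))) := by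
    have h := (hU n).1 α (k + 1) (by omega)
    have hk := hinc α hα n (k + 1)
    rw [show -((k + 1 : ℕ) : ℤ) - 1 = -(k : ℤ) - 2 by push_cast; ring] at hk
    simp only [Nat.add_sub_cancel] at h
    rw [Hp_trafficH_incoming f ρc (hγpos α) hα, Hm_trafficH_incoming f ρc (hγpos α) hα,
      max_neg_mul_eq_neg_mul_min (one_div_pos.2 (hγpos α)).le, ← hinc α hα, ← hk, min_comm] at h
    rw [h, godunovF]
    ring
  have hstep_out (α : Fin N) (hα : NI ≤ α.val) (n k : ℕ) :
      U α (n + 1) (k + 1) = U α n (k + 1) + Δt * (1 / γ α *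
        godunovF (f α) (ρc α) (ρ α n k) (ρ α n (k + 1))) := by
    have h := (hU n).1 α (k + 1) (by omega)
    have hk := hout α hα n (k + 1)
    push_cast at hk
    simp only [Nat.add_sub_cancel] at h
    rw [Hp_trafficH_outgoing f ρc (hγpos α) hα, Hm_trafficH_outgoing f ρc (hγpos α) hα,
      max_neg_mul_eq_neg_mul_min (one_div_pos.2 (hγpos α)).le, ← hout α hα, ← hk] at h
    rw [h, godunovF]
    ring
  have hstep_zero (α : Fin N) (n : ℕ) :
      U α (n + 1) 0 = U α n 0
        + Δt * junctionF0 NI γ f ρc (fun β => ρ β n (-1)) (fun lam => ρ lam n 0) := by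
    have h := (hU n).2.2 α
    rw [sSup_range_eq_neg_min_sInf (fun β : Fin N => β.val < NI) (fun β => NI ≤ β.val)
      (fun β => lt_or_ge _ _) ⟨⟨0, by omega⟩, hNI⟩ ⟨⟨NI, by omega⟩, le_rfl⟩ _
      (fun β => 1 / γ β * demandF (f β) (ρc β) (ρ β n (-1)))
      (fun β => 1 / γ β * supplyF (f β) (ρc β) (ρ β n 0))
      (fun β hβ => ?_) (fun β hβ => ?_)] at h
    · simp only [h, junctionF0]
      ring
    · have hβ0 := hinc β hβ n 0
      norm_num at hβ0
      rw [Hm_trafficH_incoming f ρc (hγpos β) hβ, hβ0]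
    · have hβ0 := hout β hβ n 0
      norm_num at hβ0
      rw [Hm_trafficH_outgoing f ρc (hγpos β) hβ, hβ0, neg_mul]
  intro n
  refine ⟨?_, fun α hα => ?_, fun α hα => ?_⟩
  · rintro α i (⟨hα, hi⟩ | ⟨hα, hi⟩)
    · obtain ⟨k, rfl⟩ : ∃ k : ℕ, i = -(k : ℤ) - 2 := ⟨(-i - 2).toNat, by omega⟩
      have hk := hinc α hα
      have h1 := hstep_in α hα n k
      have h2 := hstep_in α hα n (k + 1)
      have e1 : -((k + 1 : ℕ) : ℤ) - 1 = -(k : ℤ) - 2 := by push_cast; ring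
      have e2 : -((k + 1 : ℕ) : ℤ) - 2 = -(k : ℤ) - 2 - 1 := by push_cast; ring
      have e3 : -(k : ℤ) - 2 + 1 = -(k : ℤ) - 1 := by ring
      have hρ (m : ℕ) := hk m (k + 1)
      rw [e1] at hρ
      rw [e1, e2] at h2
      rw [e3]
      generalize godunovF (f α) (ρc α) (ρ α n (-(k : ℤ) - 2)) (ρ α n (-(k : ℤ) - 1)) = F at *
      generalize godunovF (f α) (ρc α) _ _ = G at *
      rw [hρ, hρ, h1, h2]
      have := (hγpos α).ne'
      field_simp
      ring
    · obtain ⟨k, rfl⟩ : ∃ k : ℕ, i = (k : ℤ) + 1 := ⟨(i - 1).toNat, by omega⟩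
      have h1 := hstep_out α hα n k
      have h2 := hstep_out α hα n (k + 1)
      have hρ (m : ℕ) := hout α hα m (k + 1)
      push_cast at hρ h2
      rw [add_sub_cancel_right]
      generalize godunovF (f α) (ρc α) (ρ α n k) (ρ α n (k + 1)) = F at *
      generalize godunovF (f α) (ρc α) _ _ = G at *
      rw [hρ, hρ, h1, h2]
      have := (hγpos α).ne'
      field_simp
      ring
  · have h1 := hstep_zero α n
    have h2 := hstep_out α hα n 0
    have hρ (m : ℕ) := hout α hα m 0
    simp only [Nat.cast_zero, zero_add] at hρ h2
    generalize junctionF0 NI γ f ρc _ _ = F at *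
    generalize godunovF (f α) (ρc α) _ _ = G at *
    rw [hρ, hρ, h1, h2]
    have := (hγpos α).ne'
    field_simp
    ring
  · have h1 := hstep_zero α n
    have h2 := hstep_in α hα n 0
    have hρ (m : ℕ) := hinc α hα m 0
    simp only [Nat.cast_zero, neg_zero, zero_sub, zero_add] at hρ h2
    generalize junctionF0 NI γ f ρc _ _ = F at *
    generalize godunovF (f α) (ρc α) _ _ = G at *
    rw [hρ, hρ, h1, h2]
    have := (hγpos α).ne'
    field_simp
    ring
end

section
/- (Uniform bounds on the discrete densities) In the traffic setting, let (U^{α,n}_i) solve the scheme (NS) with the traffic Hamiltonians, let ρ^{α,n}_i be the associated discrete densities, and set m⁰ = inf{W^{β,0}_i : β, i} where W^{β,0}_i = (U^{β,1}_i − U^{β,0}_i)/Δt. If the CFL condition (CFL′) is satisfied and m⁰ is finite, then with ρ⁻_α = inf{ρ ∈ ℝ : f^α_D(ρ) = γ^α m⁰} and ρ⁺_α = sup{ρ ∈ ℝ : f^α_S(ρ) = γ^α m⁰}, one has ρ⁻_α ≤ ρ^{α,n}_i ≤ ρ⁺_α for all n ≥ 0, all cells i, and all α = 1,…,N. -/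
open Set Filter

theorem Hm_eq (H : ℝ → ℝ) (p₀ p : ℝ) : Hm H p₀ p = H (min p p₀) := by
  unfold Hm
  split_ifs with h
  · rw [min_eq_left h]
  · rw [min_eq_right (not_le.mp h).le]

theorem Hp_eq (H : ℝ → ℝ) (p₀ p : ℝ) : Hp H p₀ p = H (max p p₀) := by
  unfold Hp
  split_ifs with h
  · rw [max_eq_right h]
  · rw [max_eq_left (not_le.mp h).le]

/-- Reflection turns the non-decreasing envelope into the non-increasing one. -/
theorem Hm_reflect (H : ℝ → ℝ) (p₀ p : ℝ) :
    Hm (fun q => H (-q)) (-p₀) p = Hp H p₀ (-p) := by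
  rw [Hm_eq, Hp_eq]
  congr 1
  rw [← max_neg_neg, neg_neg]

theorem A1cond.reflect {H : ℝ → ℝ} {p₀ : ℝ} (h : A1cond H p₀) :
    A1cond (fun q => H (-q)) (-p₀) := by
  obtain ⟨h1, h2, h3, h4⟩ := h
  refine ⟨h1.comp contDiff_neg, h2.comp (Homeomorph.neg ℝ).isClosedEmbedding.tendsto_cocompact,
    ?_, ?_⟩
  · intro x hx y hy hxy
    simp only [mem_Iic] at hx hy
    exact h4 (mem_Ici.2 (by linarith)) (mem_Ici.2 (by linarith)) (by linarith)
  · intro x hx y hy hxy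
    simp only [mem_Ici] at hx hy
    exact h3 (mem_Iic.2 (by linarith)) (mem_Iic.2 (by linarith)) (by linarith)

theorem A1cond.antitone_Hm {H : ℝ → ℝ} {p₀ : ℝ} (h : A1cond H p₀) : Antitone (Hm H p₀) := by
  intro x y hxy
  rw [Hm_eq, Hm_eq]
  exact h.2.2.1 (mem_Iic.2 (min_le_right _ _)) (mem_Iic.2 (min_le_right _ _))
    (min_le_min_right _ hxy)

theorem A1cond.le_Hm {H : ℝ → ℝ} {p₀ : ℝ} (h : A1cond H p₀) (p : ℝ) : H p₀ ≤ Hm H p₀ p := by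
  rw [Hm_eq]
  exact h.2.2.1 (mem_Iic.2 (min_le_right _ _)) self_mem_Iic (min_le_right _ _)

/-- A level above the minimum is attained by the non-increasing envelope, at a least point,
which lies on the left of the turning point. -/
theorem A1cond.isLeast_sInf {H : ℝ → ℝ} {p₀ c : ℝ} (h : A1cond H p₀) (hc : H p₀ ≤ c) :
    IsLeast {p | Hm H p₀ p = c} (sInf {p | Hm H p₀ p = c}) ∧
      sInf {p | Hm H p₀ p = c} ≤ p₀ := by
  have hcont : Continuous H := h.1.continuous
  have hbot : ∀ᶠ p in atBot, c < H p :=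
    (h.2.1.mono_left atBot_le_cocompact).eventually_gt_atTop c
  obtain ⟨R, hR⟩ := eventually_atBot.1 hbot
  have hbdd : BddBelow {p | Hm H p₀ p = c} := by
    refine ⟨R, fun p hp => ?_⟩
    by_contra! hlt
    have h1 : Hm H p₀ p = c := hp
    rw [Hm_eq] at h1
    exact (hR _ ((min_le_left p p₀).trans hlt.le)).ne' h1
  obtain ⟨q, hq, hqc⟩ : ∃ q ∈ Icc (min R p₀) p₀, H q = c :=
    intermediate_value_Icc' (min_le_right _ _) hcont.continuousOn
      ⟨hc, (hR _ (min_le_left _ _)).le⟩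
  have hqS : q ∈ {p | Hm H p₀ p = c} := by
    change Hm H p₀ q = c
    rw [Hm_eq, min_eq_left hq.2, hqc]
  have hclosed : IsClosed {p | Hm H p₀ p = c} := by
    simp only [Hm_eq]
    exact isClosed_eq (by fun_prop) continuous_const
  exact ⟨⟨hclosed.csInf_mem ⟨q, hqS⟩ hbdd, fun p hp => csInf_le hbdd hp⟩,
    (csInf_le hbdd hqS).trans hq.2⟩

theorem A1cond.sInf_le_of_Hm_le {H : ℝ → ℝ} {p₀ c p : ℝ} (h : A1cond H p₀)
    (hp : Hm H p₀ p ≤ c) : sInf {p | Hm H p₀ p = c} ≤ p := by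
  obtain ⟨⟨h1, h2⟩, -⟩ := h.isLeast_sInf ((h.le_Hm p).trans hp)
  by_contra! hlt
  have h3 : Hm H p₀ _ = c := h1
  exact hlt.not_ge (h2 (le_antisymm hp (h3 ▸ h.antitone_Hm hlt.le)))

theorem A1cond.Hm_le_add {H : ℝ → ℝ} {p₀ a L r p : ℝ} (h : A1cond H p₀) (ha : a ≤ p₀)
    (hL : ∀ q ∈ Icc a p₀, |deriv H q| ≤ L) (har : a ≤ r) (hrp : r ≤ p) :
    Hm H p₀ r ≤ Hm H p₀ p + L * (p - r) := by
  have hL0 : 0 ≤ L := (abs_nonneg _).trans (hL p₀ ⟨ha, le_rfl⟩)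
  have hmvt := (convex_Icc a p₀).norm_image_sub_le_of_norm_deriv_le (f := H) (C := L)
    (x := min p p₀) (y := min r p₀)
    (fun x _ => (h.1.differentiable one_ne_zero) x) hL
    ⟨le_min (har.trans hrp) ha, min_le_right _ _⟩ ⟨le_min har ha, min_le_right _ _⟩
  have hmin : |min r p₀ - min p p₀| ≤ p - r := by
    rw [abs_sub_comm]
    refine (abs_min_sub_min_le_max _ _ _ _).trans ?_
    simp [abs_of_nonneg (sub_nonneg.2 hrp), hrp]
  rw [Real.norm_eq_abs, Real.norm_eq_abs] at hmvt
  rw [Hm_eq, Hm_eq]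
  nlinarith [le_abs_self (H (min r p₀) - H (min p p₀)), mul_le_mul_of_nonneg_left hmin hL0]

/-- One time step preserves the bound `H⁻ ≤ -m` on the discrete slopes: `x, y` are neighbouring
values at a given time, `x', y'` the values at the next time. -/
theorem A1cond.Hm_step_le {H : ℝ → ℝ} {p₀ m Δx Δt x y x' y' : ℝ} (h : A1cond H p₀)
    (hΔx : 0 < Δx) (hΔt : 0 < Δt)
    (hL : ∀ q ∈ Icc (sInf {p | Hm H p₀ p = -m}) p₀, |deriv H q| ≤ Δx / Δt)
    (hM : Hm H p₀ ((y - x) / Δx) ≤ (x - x') / Δt)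
    (hx : x + Δt * m ≤ x') (hy : y + Δt * m ≤ y') :
    Hm H p₀ ((y' - x') / Δx) ≤ -m := by
  have hxm : (x - x') / Δt ≤ -m := by
    rw [div_le_iff₀ hΔt]; linarith
  have hpm := hM.trans hxm
  obtain ⟨⟨hamem, -⟩, hap₀⟩ := h.isLeast_sInf ((h.le_Hm _).trans hpm)
  have hap := h.sInf_le_of_Hm_le hpm
  set a := sInf {p | Hm H p₀ p = -m}
  have hac : Hm H p₀ a = -m := hamem
  set p := (y - x) / Δx with hp
  set q := p - (x' - x - Δt * m) / Δx with hq
  have hqp' : q ≤ (y' - x') / Δx := by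
    rw [hq, hp, ← sub_div]
    exact div_le_div_of_nonneg_right (by linarith) hΔx.le
  have hqp : q ≤ p := sub_le_self _ (div_nonneg (by linarith) hΔx.le)
  have hLpq : Δx / Δt * (p - q) = -m - (x - x') / Δt := by
    rw [hq]; field_simp; ring
  rcases le_or_gt a q with haq | hqa
  · have := h.Hm_le_add hap₀ hL haq hqp
    have := h.antitone_Hm hqp'
    linarith
  · have h1 := h.Hm_le_add hap₀ hL le_rfl hap
    have h2 : 0 < Δx / Δt * (a - q) := mul_pos (div_pos hΔx hΔt) (sub_pos.2 hqa)
    linarith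

theorem A1cond.sInf_div_le {H : ℝ → ℝ} {p₀ c p g : ℝ} (h : A1cond H p₀) (hg : 0 < g)
    (hp : Hm H p₀ p ≤ c) : sInf {r | Hm H p₀ (r / g) = c} ≤ g * p := by
  obtain ⟨⟨h1, h2⟩, -⟩ := h.isLeast_sInf ((h.le_Hm p).trans hp)
  refine (csInf_le ⟨g * sInf {p | Hm H p₀ p = c}, fun r hr => ?_⟩ ?_).trans
    (mul_le_mul_of_nonneg_left (h.sInf_le_of_Hm_le hp) hg.le)
  · have := h2 (show r / g ∈ {p | Hm H p₀ p = c} from hr)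
    rwa [le_div_iff₀' hg] at this
  · change Hm H p₀ _ = c
    rw [mul_div_cancel_left₀ _ hg.ne']
    exact h1

theorem A1cond.le_sSup_div {H : ℝ → ℝ} {p₀ c p g : ℝ} (h : A1cond H p₀) (hg : 0 < g)
    (hp : Hp H p₀ p ≤ c) : g * p ≤ sSup {r | Hp H p₀ (r / g) = c} := by
  have h1 := h.reflect.sInf_div_le (p := -p) (c := c) hg (by rwa [Hm_reflect, neg_neg])
  have h2 : {r | Hm (fun q => H (-q)) (-p₀) (r / g) = c} = -{r | Hp H p₀ (r / g) = c} := by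
    ext r
    simp [Hm_reflect, neg_div]
  rw [h2, Real.sInf_neg] at h1
  linarith

theorem demandF_eq_Hm (f : ℝ → ℝ) (ρc g r : ℝ) (hg : 0 < g) :
    -(1 / g) * demandF f ρc r = Hm (fun p => -(1 / g) * f (g * p)) (ρc / g) (r / g) := by
  unfold demandF Hm
  simp only [div_le_div_iff_of_pos_right hg, mul_div_cancel₀ _ hg.ne']
  split_ifs <;> rfl

theorem supplyF_eq_Hp (f : ℝ → ℝ) (ρc g r : ℝ) (hg : 0 < g) :
    -(1 / g) * supplyF f ρc r = Hp (fun p => -(1 / g) * f (g * p)) (ρc / g) (r / g) := by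
  unfold supplyF Hp
  simp only [div_le_div_iff_of_pos_right hg, mul_div_cancel₀ _ hg.ne']
  split_ifs <;> rfl

theorem eq_mul_iff_neg_one_div_mul_eq {g v m : ℝ} (hg : 0 < g) :
    v = g * m ↔ -(1 / g) * v = -m := by
  constructor
  · rintro rfl
    field_simp
  · intro h
    field_simp at h
    linarith

/-- The demand and supply levels of a flux, seen through the Hamiltonian `-(1/g) f (g p)`,
bound the density `g p`. -/
theorem density_mem_Icc {f : ℝ → ℝ} {ρc g m p : ℝ} (hg : 0 < g)
    (h : A1cond (fun p => -(1 / g) * f (g * p)) (ρc / g))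
    (hm : Hm (fun p => -(1 / g) * f (g * p)) (ρc / g) p ≤ -m)
    (hp : Hp (fun p => -(1 / g) * f (g * p)) (ρc / g) p ≤ -m) :
    sInf {r | demandF f ρc r = g * m} ≤ g * p ∧
      g * p ≤ sSup {r | supplyF f ρc r = g * m} := by
  simp only [eq_mul_iff_neg_one_div_mul_eq hg, demandF_eq_Hm _ _ _ _ hg,
    supplyF_eq_Hp _ _ _ _ hg]
  exact ⟨h.sInf_div_le hg hm, h.le_sSup_div hg hp⟩

/-- The slopes produced by the scheme stay in the sublevel sets of both envelopes. -/
theorem SchemeNS.slope_bounds {N : ℕ} {H : Fin N → ℝ → ℝ} {p₀ : Fin N → ℝ} {Δx Δt m : ℝ}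
    {U : Fin N → ℕ → ℕ → ℝ} (hU : SchemeNS H p₀ Δx Δt U) (hA1 : ∀ α, A1cond (H α) (p₀ α))
    (hΔx : 0 < Δx) (hΔt : 0 < Δt)
    (hm : ∀ α i, U α 0 i + Δt * m ≤ U α 1 i)
    (hCFL : ∀ α, ∀ p ∈ Icc (sInf {p | Hm (H α) (p₀ α) p = -m})
      (sSup {p | Hp (H α) (p₀ α) p = -m}), |deriv (H α) p| ≤ Δx / Δt) (n : ℕ) (α : Fin N)
    (i : ℕ) : Hm (H α) (p₀ α) ((U α n (i + 1) - U α n i) / Δx) ≤ -m ∧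
      Hp (H α) (p₀ α) ((U α n (i + 1) - U α n i) / Δx) ≤ -m := by
  have hminus : ∀ n α i, Hm (H α) (p₀ α) ((U α n (i + 1) - U α n i) / Δx) ≤
      (U α n i - U α (n + 1) i) / Δt := by
    intro n α i
    rw [le_div_iff₀' hΔt]
    rcases Nat.eq_zero_or_pos i with rfl | hi
    · have h0 := (hU n).2.2 α
      have hle := mul_le_mul_of_nonneg_left (le_csSup (Set.finite_range fun β : Fin N =>
        Hm (H β) (p₀ β) ((U β n 1 - U β n 0) / Δx)).bddAbove ⟨α, rfl⟩) hΔt.le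
      simp only at h0 hle
      linarith
    · have h0 := (hU n).1 α i hi
      have hle := mul_le_mul_of_nonneg_left (le_max_right
        (Hp (H α) (p₀ α) ((U α n i - U α n (i - 1)) / Δx))
        (Hm (H α) (p₀ α) ((U α n (i + 1) - U α n i) / Δx))) hΔt.le
      simp only at h0
      linarith
  have hplus : ∀ n α i, Hp (H α) (p₀ α) ((U α n (i + 1) - U α n i) / Δx) ≤
      (U α n (i + 1) - U α (n + 1) (i + 1)) / Δt := by
    intro n α i
    rw [le_div_iff₀' hΔt]
    have h0 := (hU n).1 α (i + 1) (by omega)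
    have hle := mul_le_mul_of_nonneg_left (le_max_left
      (Hp (H α) (p₀ α) ((U α n (i + 1) - U α n i) / Δx))
      (Hm (H α) (p₀ α) ((U α n (i + 1 + 1) - U α n (i + 1)) / Δx))) hΔt.le
    simp only [Nat.add_sub_cancel] at h0
    linarith
  have hdiv : ∀ {x x' : ℝ}, x + Δt * m ≤ x' → (x - x') / Δt ≤ -m := by
    intro x x' hx
    rw [div_le_iff₀ hΔt]
    linarith
  have hmin : ∀ α, H α (p₀ α) ≤ -m := fun α =>
    ((hA1 α).le_Hm _).trans ((hminus 0 α 0).trans (hdiv (hm α 0)))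
  have hset : ∀ α, sInf {p | Hm (fun q => H α (-q)) (-p₀ α) p = -m} =
      -sSup {p | Hp (H α) (p₀ α) p = -m} := by
    intro α
    rw [← Real.sInf_neg]
    congr 1
    ext p
    simp [Hm_reflect]
  have hlo : ∀ α, sInf {p | Hm (H α) (p₀ α) p = -m} ≤ p₀ α := fun α =>
    ((hA1 α).isLeast_sInf (hmin α)).2
  have hhi : ∀ α, p₀ α ≤ sSup {p | Hp (H α) (p₀ α) p = -m} := by
    intro α
    have := ((hA1 α).reflect.isLeast_sInf (c := -m) (by simpa using hmin α)).2
    rw [hset] at this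
    linarith
  have hCFLm : ∀ α, ∀ q ∈ Icc (sInf {p | Hm (H α) (p₀ α) p = -m}) (p₀ α),
      |deriv (H α) q| ≤ Δx / Δt := fun α q hq => hCFL α q ⟨hq.1, hq.2.trans (hhi α)⟩
  have hCFLp : ∀ α, ∀ q ∈ Icc (sInf {p | Hm (fun q => H α (-q)) (-p₀ α) p = -m}) (-p₀ α),
      |deriv (fun q => H α (-q)) q| ≤ Δx / Δt := by
    intro α q hq
    rw [hset] at hq
    rw [deriv_comp_neg, abs_neg]
    exact hCFL α (-q) ⟨by linarith [hlo α, hq.2], by linarith [hq.1]⟩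
  have htime : ∀ n α i, U α n i + Δt * m ≤ U α (n + 1) i := by
    intro n
    induction n with
    | zero => exact hm
    | succ n ih =>
      have hm' : ∀ α i,
          Hm (H α) (p₀ α) ((U α (n + 1) (i + 1) - U α (n + 1) i) / Δx) ≤ -m :=
        fun α i => (hA1 α).Hm_step_le hΔx hΔt (hCFLm α) (hminus n α i) (ih α i) (ih α (i + 1))
      have hp' : ∀ α i,
          Hp (H α) (p₀ α) ((U α (n + 1) (i + 1) - U α (n + 1) i) / Δx) ≤ -m := by
        intro α i
        have h1 := (hA1 α).reflect.Hm_step_le hΔx hΔt (hCFLp α) (x := U α n (i + 1))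
          (y := U α n i) (x' := U α (n + 1) (i + 1)) (y' := U α (n + 1) i)
          (by rw [Hm_reflect, ← neg_div, neg_sub]; exact hplus n α i) (ih α (i + 1)) (ih α i)
        rwa [Hm_reflect, ← neg_div, neg_sub] at h1
      intro α i
      rcases Nat.eq_zero_or_pos i with rfl | hi
      · have h0 := (hU (n + 1)).2.2 α
        have hne : Nonempty (Fin N) := ⟨α⟩
        have hle := mul_le_mul_of_nonneg_left (csSup_le (Set.range_nonempty fun β : Fin N =>
          Hm (H β) (p₀ β) ((U β (n + 1) 1 - U β (n + 1) 0) / Δx))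
          (by rintro _ ⟨β, rfl⟩; exact hm' β 0)) hΔt.le
        simp only at h0
        linarith
      · obtain ⟨j, rfl⟩ : ∃ j, i = j + 1 := ⟨i - 1, by omega⟩
        have h0 := (hU (n + 1)).1 α (j + 1) hi
        have hle := mul_le_mul_of_nonneg_left (max_le (hp' α j) (hm' α (j + 1))) hΔt.le
        simp only [Nat.add_sub_cancel] at h0
        linarith
  exact ⟨(hminus n α i).trans (hdiv (htime n α i)),
    (hplus n α i).trans (hdiv (htime n α (i + 1)))⟩

/-- **Uniform bounds on the discrete densities** (Remark 4.3).
In the traffic setting, if `U` solves the scheme (NS) with the traffic Hamiltonians,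
`m⁰ = inf_{β,i} W^{β,0}_i` is finite and the CFL condition (CFL′) holds, then the
discrete densities satisfy `ρ⁻_α ≤ ρ^{α,n}_i ≤ ρ⁺_α` for all `n`, all cells `i` and all
branches `α`, where `ρ⁻_α = inf{ρ | f^α_D(ρ) = γ^α m⁰}` and
`ρ⁺_α = sup{ρ | f^α_S(ρ) = γ^α m⁰}`. -/
theorem uniform_density_bounds
    (NI NO : ℕ) (hNI : 1 ≤ NI) (hNO : 1 ≤ NO) {N : ℕ} (hN : N = NI + NO)
    (γ : Fin N → ℝ) (hγ : ∀ α, 0 < γ α ∧ γ α ≤ 1)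
    (hγin : ∑ α ∈ Finset.univ.filter (fun α : Fin N => α.val < NI), γ α = 1)
    (hγout : ∑ α ∈ Finset.univ.filter (fun α : Fin N => NI ≤ α.val), γ α = 1)
    (f : Fin N → ℝ → ℝ) (ρc : Fin N → ℝ)
    (hf : ∀ α, TrafficFlux (f α) (ρc α))
    (hA1 : ∀ α, A1cond (trafficH NI γ f α) (trafficP0 NI γ ρc α))
    (Δx Δt : ℝ) (hΔx : 0 < Δx) (hΔt : 0 < Δt)
    (U : Fin N → ℕ → ℕ → ℝ)
    (hU : SchemeNS (trafficH NI γ f) (trafficP0 NI γ ρc) Δx Δt U)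
    (ρ : Fin N → ℕ → ℤ → ℝ)
    (hρin : ∀ α : Fin N, α.val < NI → ∀ (n : ℕ) (i : ℤ), i ≤ -1 →
      ρ α n i = γ α * ((U α n (-i).toNat - U α n ((-i).toNat - 1)) / Δx))
    (hρout : ∀ α : Fin N, NI ≤ α.val → ∀ (n : ℕ) (i : ℤ), 0 ≤ i →
      ρ α n i = -(γ α) * ((U α n (i.toNat + 1) - U α n i.toNat) / Δx))
    (m0 : ℝ)
    (hm0 : IsGLB (Set.range fun q : Fin N × ℕ => (U q.1 1 q.2 - U q.1 0 q.2) / Δt) m0)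
    (hCFL : ∀ α : Fin N, ∀ p ∈ Icc
        (sInf {p : ℝ | Hm (trafficH NI γ f α) (trafficP0 NI γ ρc α) p = -m0})
        (sSup {p : ℝ | Hp (trafficH NI γ f α) (trafficP0 NI γ ρc α) p = -m0}),
      |deriv (trafficH NI γ f α) p| ≤ Δx / Δt)
    (ρlo ρhi : Fin N → ℝ)
    (hρlo : ∀ α, ρlo α = sInf {r : ℝ | demandF (f α) (ρc α) r = γ α * m0})
    (hρhi : ∀ α, ρhi α = sSup {r : ℝ | supplyF (f α) (ρc α) r = γ α * m0}) :
    ∀ (n : ℕ) (α : Fin N) (i : ℤ),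
      ((α.val < NI ∧ i ≤ -1) ∨ (NI ≤ α.val ∧ 0 ≤ i)) →
      ρlo α ≤ ρ α n i ∧ ρ α n i ≤ ρhi α := by
  have hm : ∀ α i, U α 0 i + Δt * m0 ≤ U α 1 i := by
    intro α i
    have h := hm0.1 ⟨(α, i), rfl⟩
    simp only [le_div_iff₀' hΔt] at h
    linarith
  have hslope := hU.slope_bounds hA1 hΔx hΔt hm hCFL
  rintro n α i (⟨hα, hi⟩ | ⟨hα, hi⟩)
  · have hA := hA1 α
    have hs := hslope n α ((-i).toNat - 1)
    rw [Nat.sub_add_cancel (by omega)] at hs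
    have hH : trafficH NI γ f α = fun p => -(1 / γ α) * f α (γ α * p) := by
      funext p
      simp [trafficH, hα]
    have hP : trafficP0 NI γ ρc α = ρc α / γ α := by simp [trafficP0, hα]
    rw [hH, hP] at hA hs
    rw [hρlo, hρhi, hρin α hα n i hi]
    exact density_mem_Icc (hγ α).1 hA hs.1 hs.2
  · have hA := (hA1 α).reflect
    have hs := hslope n α i.toNat
    set p := (U α n (i.toNat + 1) - U α n i.toNat) / Δx
    have hm' : Hm (fun q => trafficH NI γ f α (-q)) (-trafficP0 NI γ ρc α) (-p) ≤ -m0 := by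
      rw [Hm_reflect, neg_neg]
      exact hs.2
    have hp' : Hp (fun q => trafficH NI γ f α (-q)) (-trafficP0 NI γ ρc α) (-p) ≤ -m0 := by
      rw [← Hm_reflect]
      simpa only [neg_neg] using hs.1
    have hH : (fun q => trafficH NI γ f α (-q)) = fun p => -(1 / γ α) * f α (γ α * p) := by
      funext p
      simp [trafficH, hα.not_gt]
    have hP : -trafficP0 NI γ ρc α = ρc α / γ α := by simp [trafficP0, hα.not_gt]
    rw [hH, hP] at hA hm' hp'
    rw [hρlo, hρhi, hρout α hα n i hi, neg_mul_comm]
    exact density_mem_Icc (hγ α).1 hA hm' hp'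
end

section
/- (m⁰ is the minimal initial flux) In the traffic setting, let (U^{α,0}_i) be given, let (U^{α,1}_i) be computed from it by the scheme (NS) with the traffic Hamiltonians, let ρ^{α,0}_i be the associated discrete initial densities, and set m⁰ = inf{W^{β,0}_i : β = 1,…,N, i ∈ ℕ} with W^{β,0}_i = (U^{β,1}_i − U^{β,0}_i)/Δt. Then m⁰ = min{ min over incoming α ≤ N_I and cells i ≤ −1 of (1/γ^α) f^α(ρ^{α,0}_i), min over outgoing α ≥ N_I+1 and cells i ≥ 0 of (1/γ^α) f^α(ρ^{α,0}_i) } (infima over the infinitely many cells), i.e. m⁰ equals the infimum of the initial fluxes f^α(ρ^{α,0}_i)/γ^α over all cells of all branches. -/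
open Set Filter

theorem Hm_le_self {H : ℝ → ℝ} {p₀ : ℝ} (h : ∀ p, H p₀ ≤ H p) (p : ℝ) : Hm H p₀ p ≤ H p := by
  unfold Hm
  split_ifs
  exacts [le_rfl, h p]

theorem Hp_le_self {H : ℝ → ℝ} {p₀ : ℝ} (h : ∀ p, H p₀ ≤ H p) (p : ℝ) : Hp H p₀ p ≤ H p := by
  unfold Hp
  split_ifs
  exacts [h p, le_rfl]

theorem self_le_of_Hm_le_of_Hp_le {H : ℝ → ℝ} {p₀ p c : ℝ} (hm : Hm H p₀ p ≤ c)
    (hp : Hp H p₀ p ≤ c) : H p ≤ c := by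
  unfold Hm at hm
  unfold Hp at hp
  split_ifs at hm hp <;> assumption

theorem trafficH_trafficP0_le (NI : ℕ) {N : ℕ} {γ : Fin N → ℝ} {f : Fin N → ℝ → ℝ}
    {ρc : Fin N → ℝ} {α : Fin N} (hγ : 0 < γ α) (hf : TrafficFlux (f α) (ρc α)) (p : ℝ) :
    trafficH NI γ f α (trafficP0 NI γ ρc α) ≤ trafficH NI γ f α p := by
  have hmax : ∀ q, f α q ≤ f α (ρc α) := fun q => by
    rcases eq_or_ne q (ρc α) with rfl | hq
    exacts [le_rfl, (hf.2.2.2 q hq).le]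
  have hneg : -(1 / γ α) ≤ 0 := neg_nonpos.2 (by positivity)
  unfold trafficH trafficP0
  split_ifs
  · rw [mul_div_cancel₀ _ hγ.ne']
    exact mul_le_mul_of_nonpos_left (hmax _) hneg
  · rw [mul_neg, neg_neg, mul_div_cancel₀ _ hγ.ne']
    exact mul_le_mul_of_nonpos_left (hmax _) hneg

/-- The discrete time derivatives after one step of the scheme and the values `-H_α(p^α_{i,+})`
have the same lower bounds. -/
theorem SchemeStep.lowerBounds_range_eq {N : ℕ} {H : Fin N → ℝ → ℝ} {p₀ : Fin N → ℝ}
    {Δx Δt : ℝ} (hΔt : 0 < Δt) {U V : Fin N → ℕ → ℝ} (hstep : SchemeStep H p₀ Δx Δt U V)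
    (hH : ∀ α p, H α (p₀ α) ≤ H α p) :
    lowerBounds (range fun q : Fin N × ℕ => (V q.1 q.2 - U q.1 q.2) / Δt) =
      lowerBounds (range fun q : Fin N × ℕ =>
        -H q.1 ((U q.1 (q.2 + 1) - U q.1 q.2) / Δx)) := by
  obtain ⟨hpos, -, hzero⟩ := hstep
  have hW : ∀ u x : ℝ, (u - Δt * x - u) / Δt = -x := fun u x => by
    field_simp
    ring
  ext m
  simp only [mem_lowerBounds, forall_mem_range, Prod.forall]
  constructor
  · intro h α i
    have hHp : Hp (H α) (p₀ α) ((U α (i + 1) - U α i) / Δx) ≤ -m := by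
      have h1 := h α (i + 1)
      rw [hpos α (i + 1) (by omega), hW, le_neg, max_le_iff] at h1
      exact h1.1
    have hHm : Hm (H α) (p₀ α) ((U α (i + 1) - U α i) / Δx) ≤ -m := by
      have h1 := h α i
      rcases Nat.eq_zero_or_pos i with rfl | hi
      · rw [hzero α, hW, le_neg] at h1
        exact (le_csSup (finite_range _).bddAbove (mem_range_self α)).trans h1
      · rw [hpos α i hi, hW, le_neg, max_le_iff] at h1
        exact h1.2
    exact le_neg.2 (self_le_of_Hm_le_of_Hp_le hHm hHp)
  · intro h α i
    rcases Nat.eq_zero_or_pos i with rfl | hi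
    · rw [hzero α, hW, le_neg]
      have : Nonempty (Fin N) := ⟨α⟩
      refine csSup_le (range_nonempty _) (forall_mem_range.2 fun β => ?_)
      exact (Hm_le_self (hH β) _).trans (le_neg.2 (h β 0))
    · rw [hpos α i hi, hW, le_neg]
      refine max_le ((Hp_le_self (hH α) _).trans ?_) ((Hm_le_self (hH α) _).trans (le_neg.2 (h α i)))
      have h1 := h α (i - 1)
      rw [Nat.sub_add_cancel hi] at h1
      exact le_neg.2 h1

/-- **`m⁰` is the minimal initial flux** (Remark 4.3).
In the traffic setting, if `U1` is computed from the initial data `U0` by the scheme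
(NS) with the traffic Hamiltonians and `m⁰ = inf_{β,i} W^{β,0}_i` (encoded by `IsGLB`),
then `m⁰` is the infimum of the initial fluxes `f^α(ρ^{α,0}_i)/γ^α` over all the cells
of all the branches. -/
theorem m0_is_minimal_initial_flux
    (NI NO : ℕ) (hNI : 1 ≤ NI) (hNO : 1 ≤ NO) {N : ℕ} (hN : N = NI + NO)
    (γ : Fin N → ℝ) (hγ : ∀ α, 0 < γ α ∧ γ α ≤ 1)
    (hγin : ∑ α ∈ Finset.univ.filter (fun α : Fin N => α.val < NI), γ α = 1)
    (hγout : ∑ α ∈ Finset.univ.filter (fun α : Fin N => NI ≤ α.val), γ α = 1)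
    (f : Fin N → ℝ → ℝ) (ρc : Fin N → ℝ)
    (hf : ∀ α, TrafficFlux (f α) (ρc α))
    (Δx Δt : ℝ) (hΔx : 0 < Δx) (hΔt : 0 < Δt)
    (U0 U1 : Fin N → ℕ → ℝ)
    (hstep : SchemeStep (trafficH NI γ f) (trafficP0 NI γ ρc) Δx Δt U0 U1)
    (ρ0 : Fin N → ℤ → ℝ)
    (hρin : ∀ α : Fin N, α.val < NI → ∀ i : ℤ, i ≤ -1 →
      ρ0 α i = γ α * ((U0 α (-i).toNat - U0 α ((-i).toNat - 1)) / Δx))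
    (hρout : ∀ α : Fin N, NI ≤ α.val → ∀ i : ℤ, 0 ≤ i →
      ρ0 α i = -(γ α) * ((U0 α (i.toNat + 1) - U0 α i.toNat) / Δx))
    (m0 : ℝ)
    (hm0 : IsGLB (Set.range fun q : Fin N × ℕ => (U1 q.1 q.2 - U0 q.1 q.2) / Δt) m0) :
    IsGLB {v : ℝ | ∃ (α : Fin N) (i : ℤ),
      ((α.val < NI ∧ i ≤ -1) ∨ (NI ≤ α.val ∧ 0 ≤ i)) ∧
      v = (1 / γ α) * f α (ρ0 α i)} m0 := by
  have hset : {v : ℝ | ∃ (α : Fin N) (i : ℤ),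
      ((α.val < NI ∧ i ≤ -1) ∨ (NI ≤ α.val ∧ 0 ≤ i)) ∧ v = (1 / γ α) * f α (ρ0 α i)} =
      range fun q : Fin N × ℕ =>
        -trafficH NI γ f q.1 ((U0 q.1 (q.2 + 1) - U0 q.1 q.2) / Δx) := by
    ext v
    simp only [mem_ofPred_eq, mem_range, Prod.exists]
    constructor
    · rintro ⟨α, i, ⟨hα, hi⟩ | ⟨hα, hi⟩, rfl⟩
      · refine ⟨α, (-i).toNat - 1, ?_⟩
        rw [hρin α hα i hi, Nat.sub_add_cancel (by omega), trafficH, if_pos hα]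
        ring
      · refine ⟨α, i.toNat, ?_⟩
        rw [hρout α hα i hi, trafficH, if_neg hα.not_gt, neg_mul (γ α)]
        ring
    · rintro ⟨α, j, rfl⟩
      rcases lt_or_ge α.val NI with hα | hα
      · refine ⟨α, -((j + 1 : ℕ) : ℤ), Or.inl ⟨hα, by omega⟩, ?_⟩
        rw [hρin α hα _ (by omega), trafficH, if_pos hα, neg_neg, Int.toNat_natCast,
          Nat.add_sub_cancel]
        ring
      · refine ⟨α, j, Or.inr ⟨hα, by omega⟩, ?_⟩
        rw [hρout α hα _ (by omega), trafficH, if_neg hα.not_gt, Int.toNat_natCast,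
          neg_mul (γ α)]
        ring
  rw [hset, IsGLB, ← hstep.lowerBounds_range_eq hΔt
    fun α => trafficH_trafficP0_le NI (hγ α).1 (hf α)]
  exact hm0
end
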